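/- arXiv:cs/0412108 — 3 statements merged into one kernel-verified Lean document; each statement's English description precedes it below -/
import Mathlib

section
/- For the discrete-time Gaussian channel Y_i = √snr · X_i + N_i, i = 1, …, n, the input–output mutual information is sandwiched between the total filtering error and the total one-step prediction error: (snr/2) Σ_{i=1}^{n} cmmse(i, snr) ≤ I(Xⁿ; Yⁿ) ≤ (snr/2) Σ_{i=1}^{n} pmmse(i, snr). -/
open MeasureTheory ProbabilityTheory Real Filter
open scoped ENNReal NNReal Topology

noncomputable section

open scoped Classical in
/-- Kullback–Leibler divergence `D(μ ‖ ν)` in nats, with values in `[0, ∞]`. -/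
def klDiv {α : Type*} [MeasurableSpace α] (μ ν : Measure α) : ℝ≥0∞ :=
  if μ ≪ ν ∧ Integrable (llr μ ν) μ then ENNReal.ofReal (∫ x, llr μ ν x ∂μ) else ⊤

/-- Mutual information `I(A; B)` in nats: the KL divergence of the joint law of `(A, B)`
from the product of its marginals. -/
def mutualInfo {Ω α β : Type*} [MeasurableSpace Ω] [MeasurableSpace α] [MeasurableSpace β]
    (μ : Measure Ω) (A : Ω → α) (B : Ω → β) : ℝ≥0∞ :=
  klDiv (μ.map fun ω => (A ω, B ω)) ((μ.map A).prod (μ.map B))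

/-- Output of the discrete-time Gaussian channel `Y_i = √snr · X_i + N_i`, `i = 1, …, n`. -/
def chOutN {Ω : Type*} {n : ℕ} (X N : Ω → Fin n → ℝ) (snr : ℝ) : Ω → Fin n → ℝ :=
  fun ω i => Real.sqrt snr * X ω i + N ω i

/-- The σ-algebra generated by the observations `Y_1, …, Y_m` (the first `m` coordinates). -/
def obsSigma {Ω : Type*} [MeasurableSpace Ω] {n : ℕ} (Y : Ω → Fin n → ℝ) (m : ℕ)
    (hm : m ≤ n) : MeasurableSpace Ω :=
  MeasurableSpace.comap (fun ω => fun j : Fin m => Y ω (Fin.castLE hm j)) inferInstance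


lemma cdf_aux (w : ℝ → ℝ) (hw : Continuous w) (hpos : ∀ x, 0 < w x) (hi : Integrable w)
    (h1 : ∫ x, w x = 1) :
    ∃ W : ℝ → ℝ, (∀ x, HasDerivAt W (w x) x) ∧ StrictMono W ∧ (∀ x, 0 < W x ∧ W x < 1) ∧
      Tendsto W atBot (𝓝 0) ∧ Tendsto W atTop (𝓝 1) := by
  have hW : ∀ x, HasDerivAt (fun x => ∫ t in Set.Iic x, w t) (w x) x := by
    intro x
    have h : (fun x => ∫ t in Set.Iic x, w t)
        = fun x => (∫ t in Set.Iic (0:ℝ), w t) + ∫ t in (0:ℝ)..x, w t := by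
      funext y
      rw [← intervalIntegral.integral_Iic_sub_Iic hi.integrableOn hi.integrableOn]; ring
    rw [h]
    exact (intervalIntegral.integral_hasDerivAt_right (hi.intervalIntegrable)
      (hw.stronglyMeasurableAtFilter _ _) hw.continuousAt).const_add _
  have hm : StrictMono (fun x => ∫ t in Set.Iic x, w t) :=
    strictMono_of_deriv_pos (fun x => by rw [(hW x).deriv]; exact hpos x)
  have hbot : Tendsto (fun x => ∫ t in Set.Iic x, w t) atBot (𝓝 0) :=
    tendsto_integral_Iic_zero tendsto_id
  have htop : Tendsto (fun x => ∫ t in Set.Iic x, w t) atTop (𝓝 1) := by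
    rw [← h1]
    exact (aecover_Iic tendsto_id).integral_tendsto_of_countably_generated hi
  refine ⟨_, hW, hm, fun x => ⟨?_, ?_⟩, hbot, htop⟩
  · exact (hm.monotone.le_of_tendsto hbot (x-1)).trans_lt (hm (by linarith))
  · exact (hm (by linarith : x < x+1)).trans_le (hm.monotone.ge_of_tendsto htop (x+1))

lemma exists_transport (w v : ℝ → ℝ) (hw : Continuous w) (hwpos : ∀ x, 0 < w x)
    (hwi : Integrable w) (hw1 : ∫ x, w x = 1)
    (hv : Continuous v) (hvpos : ∀ x, 0 < v x) (hvi : Integrable v) (hv1 : ∫ x, v x = 1) :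
    ∃ T : ℝ → ℝ, Continuous T ∧ StrictMono T ∧ ∀ x, HasDerivAt T (w x / v (T x)) x := by
  obtain ⟨W, hWd, hWm, hWr, hWb, hWt⟩ := cdf_aux w hw hwpos hwi hw1
  obtain ⟨V, hVd, hVm, hVr, hVb, hVt⟩ := cdf_aux v hv hvpos hvi hv1
  have hWc : Continuous W := continuous_iff_continuousAt.2 fun x => (hWd x).continuousAt
  have hVc : Continuous V := continuous_iff_continuousAt.2 fun x => (hVd x).continuousAt
  have ex : ∀ (U : ℝ → ℝ), Continuous U → Tendsto U atBot (𝓝 0) → Tendsto U atTop (𝓝 1) →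
      ∀ c, 0 < c ∧ c < 1 → ∃ t, U t = c := by
    intro U hU hb ht c hc
    obtain ⟨a, ha⟩ := (hb.eventually (gt_mem_nhds hc.1)).exists
    obtain ⟨b, hb⟩ := (ht.eventually (lt_mem_nhds hc.2)).exists
    exact mem_range_of_exists_le_of_exists_ge hU ⟨a, ha.le⟩ ⟨b, hb.le⟩
  choose T hT using fun x => ex V hVc hVb hVt (W x) (hWr x)
  have hTm : StrictMono T := fun x y hxy => by
    have := hWm hxy
    rw [← hT, ← hT] at this
    exact hVm.lt_iff_lt.1 this
  have hTs : Function.Surjective T := fun t => by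
    obtain ⟨x, hx⟩ := ex W hWc hWb hWt (V t) (hVr t)
    exact ⟨x, hVm.injective (by rw [hT, hx])⟩
  have hTc : Continuous T := hTm.monotone.continuous_of_surjective hTs
  refine ⟨T, hTc, hTm, fun x => ?_⟩
  rw [hasDerivAt_iff_tendsto_slope]
  have h1 := (hasDerivAt_iff_tendsto_slope.1 (hWd x))
  have h2 := (hasDerivAt_iff_tendsto_slope.1 (hVd (T x)))
  have h3 : Tendsto T (𝓝[≠] x) (𝓝[≠] (T x)) := by
    refine tendsto_nhdsWithin_iff.2 ⟨hTc.continuousAt.tendsto.mono_left nhdsWithin_le_nhds, ?_⟩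
    filter_upwards [self_mem_nhdsWithin] with y hy
    exact fun h => hy (hTm.injective h)
  refine (h1.div (h2.comp h3) (hvpos _).ne').congr' ?_
  filter_upwards [self_mem_nhdsWithin] with y hy
  have hne : T y - T x ≠ 0 := sub_ne_zero.2 fun h => hy (hTm.injective h)
  have hne2 : W y - W x ≠ 0 := sub_ne_zero.2 fun h => hy (hWm.injective h)
  have hne3 : y - x ≠ 0 := sub_ne_zero.2 hy
  simp only [Pi.div_apply, Function.comp, slope_def_field, hT]
  field_simp

lemma exists_small_of_integrable (h : ℝ → ℝ) (hi : Integrable h) (ε : ℝ) (hε : 0 < ε) (R : ℝ) :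
    (∃ b, R < b ∧ |h b| ≤ ε) ∧ (∃ a, a < R ∧ |h a| ≤ ε) := by
  have hfin := hi.norm.measure_ge_lt_top hε
  constructor
  · by_contra! hc
    have : volume (Set.Ioi R) ≤ volume {a : ℝ | ε ≤ ‖h a‖} :=
      measure_mono fun x hx => (hc x hx).le
    simp at this
    exact absurd this hfin.ne
  · by_contra! hc
    have : volume (Set.Iio R) ≤ volume {a : ℝ | ε ≤ ‖h a‖} :=
      measure_mono fun x hx => (hc x hx).le
    simp at this
    exact absurd this hfin.ne

abbrev g01 : Measure ℝ := gaussianReal 0 1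
abbrev ph (x : ℝ) : ℝ := gaussianPDFReal 0 1 x

lemma ph_eq (x : ℝ) : ph x = (√(2 * π))⁻¹ * rexp (- x ^ 2 / 2) := by
  simp [ph, gaussianPDFReal]

lemma ph_pos (x : ℝ) : 0 < ph x := gaussianPDFReal_pos _ _ _ (by simp)

lemma ph_cont : Continuous ph := by
  have : ph = fun x => (√(2 * π))⁻¹ * rexp (- x ^ 2 / 2) := funext ph_eq
  rw [this]; fun_prop

lemma ph_deriv (x : ℝ) : HasDerivAt ph (- x * ph x) x := by
  have : ph = fun x => (√(2 * π))⁻¹ * rexp (- x ^ 2 / 2) := funext ph_eq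
  have h2 : HasDerivAt (fun x : ℝ => - x ^ 2 / 2) (-x) x := by
    have := ((hasDerivAt_pow 2 x).neg).div_const 2
    convert! this using 1
    simp; ring
  rw [ph_eq, this]
  convert! (h2.exp.const_mul (√(2 * π))⁻¹) using 1
  ring

lemma integrable_g01 (f : ℝ → ℝ) : Integrable f g01 ↔ Integrable (fun x => f x * ph x) := by
  rw [g01, gaussianReal_of_var_ne_zero _ (by simp), integrable_withDensity_iff]
  · simp [ph]
  · exact measurable_gaussianPDF _ _
  · exact ae_of_all _ fun x => gaussianPDF_lt_top

lemma integral_g01 (f : ℝ → ℝ) : ∫ x, f x ∂g01 = ∫ x, f x * ph x := by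
  rw [g01, integral_gaussianReal_eq_integral_smul (by simp)]
  simp [ph, mul_comm]

lemma lsi (f g : ℝ → ℝ) (hf : ∀ t, 0 < f t) (hd : ∀ t, HasDerivAt f (g t) t)
    (hg : Continuous g) (hfi : Integrable f g01) (hf1 : ∫ x, f x ∂g01 = 1)
    (hft : Integrable (fun t => t * f t) g01)
    (hlog : Integrable (fun t => f t * log (f t)) g01)
    (hfis : Integrable (fun t => g t ^ 2 / f t) g01) :
    ∫ t, f t * log (f t) ∂g01 ≤ 1 / 2 * ∫ t, g t ^ 2 / f t ∂g01 := by
  have hfc : Continuous f := continuous_iff_continuousAt.2 fun x => (hd x).continuousAt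
  have hvi : Integrable ph := integrable_gaussianPDFReal 0 1
  have hv1 : ∫ x, ph x = 1 := integral_gaussianPDFReal_eq_one 0 (by simp)
  rw [integrable_g01] at hfi hft hlog hfis
  rw [integral_g01] at hf1
  obtain ⟨T, hTc, hTm, hTd⟩ := exists_transport (fun x => f x * ph x) ph (hfc.mul ph_cont)
    (fun x => mul_pos (hf x) (ph_pos x)) hfi hf1 ph_cont ph_pos hvi hv1
  -- integrability of `T` against `f ph`
  have hTi : Integrable (fun x => T x * (f x * ph x)) := by
    have h0 : Integrable (fun y => y * ph y) := by
      rw [← integrable_g01]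
      exact (memLp_id_gaussianReal' 1 (by simp)).integrable le_rfl
    have := (integrableOn_image_iff_integrableOn_deriv_smul_of_monotoneOn (s := Set.univ)
      MeasurableSet.univ (fun x _ => (hTd x).hasDerivWithinAt) (hTm.monotone.monotoneOn _)
      (fun y => y * ph y)).1 h0.integrableOn
    rw [integrableOn_univ] at this
    refine this.congr (ae_of_all _ fun x => ?_)
    have := (ph_pos (T x)).ne'
    simp only [smul_eq_mul]
    field_simp
  set h : ℝ → ℝ := fun x => f x * ph x * (T x - x) with hh
  have hhi : Integrable h := by
    refine (hTi.sub hft).congr (ae_of_all _ fun x => ?_)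
    simp only [hh, Pi.sub_apply]; ring
  set h' : ℝ → ℝ := fun x => (g x * ph x + f x * (- x * ph x)) * (T x - x)
    + f x * ph x * (f x * ph x / ph (T x) - 1) with hh'
  have hhd : ∀ x, HasDerivAt h (h' x) x := fun x =>
    ((hd x).mul (ph_deriv x)).mul ((hTd x).sub (hasDerivAt_id x))
  have hh'c : Continuous h' := by
    have h1 := ph_cont
    have h2 : Continuous fun x => f x * ph x / ph (T x) :=
      (hfc.mul ph_cont).div (ph_cont.comp hTc) fun x => (ph_pos _).ne'
    fun_prop
  set k : ℝ → ℝ := fun x => f x * log (f x) * ph x - 1 / 2 * (g x ^ 2 / f x * ph x) with hk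
  have hki : Integrable k := hlog.sub (hfis.const_mul _)
  have hkh : ∀ x, k x ≤ h' x := by
    intro x
    have hfx := hf x
    have hpx := ph_pos x
    have hpT := ph_pos (T x)
    set D := f x * ph x / ph (T x) with hD
    have hDpos : 0 < D := by positivity
    have hlogf : log (f x) = log D - T x ^ 2 / 2 + x ^ 2 / 2 := by
      rw [hD, log_div (by positivity) (by positivity), log_mul hfx.ne' hpx.ne', ph_eq, ph_eq,
        log_mul (by positivity) (exp_pos _).ne', log_mul (by positivity) (exp_pos _).ne',
        log_exp, log_exp]
      ring
    have hl : log (f x) ≤ D - 1 - T x ^ 2 / 2 + x ^ 2 / 2 := by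
      rw [hlogf]; linarith [log_le_sub_one_of_pos hDpos]
    have key : h' x - k x = ph x * (f x * (D - 1 - T x ^ 2 / 2 + x ^ 2 / 2 - log (f x))
        + 1 / 2 * f x * (g x / f x + (T x - x)) ^ 2) := by
      simp only [hh', hk, ← hD]
      field_simp
      ring
    have : 0 ≤ h' x - k x := by
      rw [key]
      have : 0 ≤ D - 1 - T x ^ 2 / 2 + x ^ 2 / 2 - log (f x) := by linarith
      positivity
    linarith
  have hle : ∀ a b, a ≤ b → ∫ x in a..b, k x ≤ h b - h a := by
    intro a b hab
    rw [← intervalIntegral.integral_eq_sub_of_hasDerivAt (fun x _ => hhd x)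
      (hh'c.intervalIntegrable _ _)]
    exact intervalIntegral.integral_mono_on hab hki.intervalIntegrable
      (hh'c.intervalIntegrable _ _) fun x _ => hkh x
  have hs : ∀ j : ℕ, ∃ a b, a < -(j:ℝ) ∧ (j:ℝ) < b ∧ |h a| ≤ 1 / ((j:ℝ) + 1) ∧
      |h b| ≤ 1 / ((j:ℝ) + 1) := fun j => by
    obtain ⟨⟨b, hb, hb'⟩, -⟩ := exists_small_of_integrable h hhi (1 / ((j:ℝ) + 1)) (by positivity) j
    obtain ⟨-, ⟨a, ha, ha'⟩⟩ :=
      exists_small_of_integrable h hhi (1 / ((j:ℝ) + 1)) (by positivity) (-j)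
    exact ⟨a, b, ha, hb, ha', hb'⟩
  choose a b ha hb ha' hb' using hs
  have hat : Tendsto a atTop atBot := tendsto_atBot_mono (fun j => (ha j).le)
    (tendsto_neg_atTop_atBot.comp tendsto_natCast_atTop_atTop)
  have hbt : Tendsto b atTop atTop := tendsto_atTop_mono (fun j => (hb j).le)
    tendsto_natCast_atTop_atTop
  have hlim := intervalIntegral_tendsto_integral hki hat hbt
  have hz : Tendsto (fun j : ℕ => 2 * (1 / ((j:ℝ) + 1))) atTop (𝓝 (2 * 0)) :=
    tendsto_one_div_add_atTop_nhds_zero_nat.const_mul 2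
  have hfin : ∫ x, k x ≤ 2 * 0 := by
    refine le_of_tendsto_of_tendsto' hlim hz fun j => ?_
    have h0 : (0:ℝ) ≤ j := Nat.cast_nonneg j
    refine (hle (a j) (b j) (by linarith [ha j, hb j])).trans ?_
    linarith [abs_le.1 (ha' j), abs_le.1 (hb' j)]
  have : ∫ x, k x = (∫ x, f x * log (f x) * ph x) - 1 / 2 * ∫ x, g x ^ 2 / f x * ph x := by
    rw [← integral_const_mul, ← integral_sub hlog (hfis.const_mul _)]
  rw [integral_g01, integral_g01]
  linarith

/-! ### Shifts of Gaussian measures -/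

abbrev Gn (n : ℕ) : Measure (Fin n → ℝ) := Measure.pi fun _ : Fin n => gaussianReal 0 1

lemma g01_map_add (b : ℝ) :
    g01.map (fun t => b + t) = g01.withDensity (fun t => ENNReal.ofReal (rexp (b * t - b ^ 2 / 2))) := by
  rw [g01, gaussianReal_map_const_add, gaussianReal_of_var_ne_zero _ (by simp),
    gaussianReal_of_var_ne_zero _ (by simp),
    ← withDensity_mul _ (measurable_gaussianPDF _ _) (by fun_prop)]
  congr 1
  funext t
  simp only [Pi.mul_apply, gaussianPDF]
  rw [← ENNReal.ofReal_mul (gaussianPDFReal_nonneg _ _ _)]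
  congr 1
  simp only [gaussianPDFReal]
  rw [mul_assoc _ (rexp _) (rexp _), ← exp_add]
  congr 2
  simp
  ring

lemma Gn_map_add {n : ℕ} (b : Fin n → ℝ) :
    (Gn n).map (fun y => b + y) = (Gn n).withDensity
      (fun y => ENNReal.ofReal (rexp (∑ j, (b j * y j - b j ^ 2 / 2)))) := by
  have h1 : (Gn n).map (fun y => b + y) = Measure.pi fun j => g01.map (fun t => b j + t) := by
    rw [← Measure.pi_map_pi (fun i => by fun_prop)]
    rfl
  rw [h1]
  refine Measure.pi_eq fun s hs => ?_
  rw [withDensity_apply _ (MeasurableSet.univ_pi hs), ← lintegral_indicator (MeasurableSet.univ_pi hs)]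
  have h2 : ∀ y : Fin n → ℝ, (Set.univ.pi s).indicator
      (fun y => ENNReal.ofReal (rexp (∑ j, (b j * y j - b j ^ 2 / 2)))) y
      = ∏ j, (s j).indicator (fun t => ENNReal.ofReal (rexp (b j * t - b j ^ 2 / 2))) (y j) := by
    intro y
    by_cases hy : y ∈ Set.univ.pi s
    · rw [Set.indicator_of_mem hy, exp_sum, ENNReal.ofReal_prod_of_nonneg (fun _ _ => (exp_pos _).le)]
      refine Finset.prod_congr rfl fun j _ => ?_
      rw [Set.indicator_of_mem (hy j trivial)]
    · rw [Set.indicator_of_notMem hy]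
      simp only [Set.mem_pi, Set.mem_univ, true_imp_iff, not_forall] at hy
      obtain ⟨j, hj⟩ := hy
      exact (Finset.prod_eq_zero (Finset.mem_univ j) (Set.indicator_of_notMem hj _)).symm
  simp_rw [h2]
  have hm : ∀ j, Measurable ((s j).indicator
      (fun t => ENNReal.ofReal (rexp (b j * t - b j ^ 2 / 2)))) :=
    fun j => Measurable.indicator (by fun_prop) (hs j)
  rw [lintegral_prod_eq_prod_lintegral_of_indepFun Finset.univ
    (fun j (y : Fin n → ℝ) => (s j).indicator (fun t => ENNReal.ofReal (rexp (b j * t - b j ^ 2 / 2))) (y j))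
    (iIndepFun_pi fun j => (hm j).aemeasurable) (fun j => (hm j).comp (measurable_pi_apply j))]
  refine Finset.prod_congr rfl fun j _ => ?_
  rw [g01_map_add, withDensity_apply _ (hs j), ← lintegral_indicator (hs j)]
  exact ((measurePreserving_eval (fun _ : Fin n => gaussianReal 0 1) j).lintegral_comp (hm j))

lemma map_prod_withDensity {E F : Type*} [MeasurableSpace E] [MeasurableSpace F]
    (P : Measure E) [SFinite P] (Q : Measure F) [SFinite Q] (S : E → F → F) (l : E → F → ℝ≥0∞)
    (hS : Measurable (Function.uncurry S)) (hl : Measurable (Function.uncurry l))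
    (h : ∀ e, Q.map (S e) = Q.withDensity (l e)) :
    (P.prod Q).map (fun z => (z.1, S z.1 z.2)) = (P.prod Q).withDensity (Function.uncurry l) := by
  have hm : Measurable (fun z : E × F => (z.1, S z.1 z.2)) := measurable_fst.prodMk hS
  ext A hA
  rw [Measure.map_apply hm hA, withDensity_apply _ hA, ← lintegral_indicator hA,
    Measure.prod_apply (hm hA), lintegral_prod _ (hl.indicator hA).aemeasurable]
  refine lintegral_congr fun e => ?_
  have h1 : Prod.mk e ⁻¹' ((fun z : E × F => (z.1, S z.1 z.2)) ⁻¹' A) = S e ⁻¹' (Prod.mk e ⁻¹' A) := rfl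
  have hAe : MeasurableSet (Prod.mk e ⁻¹' A) := measurable_prodMk_left hA
  have hSe : Measurable (S e) := hS.comp measurable_prodMk_left
  rw [h1, ← Measure.map_apply hSe hAe, h e, withDensity_apply _ hAe,
    ← lintegral_indicator hAe]
  rfl

lemma update_mp {n : ℕ} (i : Fin n) :
    MeasurePreserving (fun z : (Fin n → ℝ) × ℝ => Function.update z.1 i z.2)
      ((Gn n).prod g01) (Gn n) := by
  have hm : Measurable (fun z : (Fin n → ℝ) × ℝ => Function.update z.1 i z.2) := by
    refine measurable_pi_iff.2 fun j => ?_
    by_cases h : j = i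
    · subst h; simpa using measurable_snd
    · simp only [Function.update_of_ne h]; fun_prop
  refine ⟨hm, (Measure.pi_eq fun s hs => ?_).symm⟩
  rw [Measure.map_apply hm (MeasurableSet.univ_pi hs)]
  have : (fun z : (Fin n → ℝ) × ℝ => Function.update z.1 i z.2) ⁻¹' Set.univ.pi s
      = (Set.univ.pi (Function.update s i Set.univ)) ×ˢ (s i) := by
    ext ⟨y, t⟩
    simp only [Set.mem_preimage, Set.mem_pi, Set.mem_univ, true_imp_iff, Set.mem_prod]
    constructor
    · intro h
      refine ⟨fun j => ?_, by simpa using h i⟩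
      by_cases hj : j = i
      · subst hj; simp
      · simpa [hj] using h j
    · rintro ⟨h, ht⟩ j
      by_cases hj : j = i
      · subst hj; simpa using ht
      · simpa [hj] using h j
  rw [this, Measure.prod_prod, Measure.pi_pi, ← Finset.mul_prod_erase _ _ (Finset.mem_univ i),
    ← Finset.mul_prod_erase Finset.univ _ (Finset.mem_univ i)]
  simp only [Function.update_self, measure_univ, one_mul]
  rw [mul_comm]
  congr 1
  refine Finset.prod_congr rfl fun j hj => ?_
  rw [Function.update_of_ne (Finset.ne_of_mem_erase hj)]

/-! ### Likelihoods -/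

def Lk {n : ℕ} (a x y : Fin n → ℝ) : ℝ := rexp (∑ j, (a j * x j * y j - (a j * x j) ^ 2 / 2))

def pk {n : ℕ} (P : Measure (Fin n → ℝ)) (a y : Fin n → ℝ) : ℝ := ∫ x, Lk a x y ∂P

def gk {n : ℕ} (P : Measure (Fin n → ℝ)) (a : Fin n → ℝ) (i : Fin n) (y : Fin n → ℝ) : ℝ :=
  ∫ x, x i * Lk a x y ∂P

section lik
variable {n : ℕ} (P : Measure (Fin n → ℝ)) [IsProbabilityMeasure P] (a : Fin n → ℝ)

lemma Lk_pos (a x y : Fin n → ℝ) : 0 < Lk a x y := exp_pos _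

lemma Lk_le (a x y : Fin n → ℝ) : Lk a x y ≤ rexp (∑ j, y j ^ 2 / 2) := by
  refine exp_le_exp.2 (Finset.sum_le_sum fun j _ => ?_)
  nlinarith [sq_nonneg (a j * x j - y j)]

lemma Lk_meas : Measurable (fun z : (Fin n → ℝ) × (Fin n → ℝ) => Lk a z.1 z.2) := by
  unfold Lk; fun_prop

lemma Lk_int (y : Fin n → ℝ) : Integrable (fun x => Lk a x y) P := by
  refine Integrable.of_bound (C := rexp (∑ j, y j ^ 2 / 2))
    ((Lk_meas a).comp measurable_prodMk_right).aestronglyMeasurable (ae_of_all _ fun x => ?_)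
  rw [norm_of_nonneg (Lk_pos _ _ _).le]; exact Lk_le _ _ _

lemma xLk_int {f : (Fin n → ℝ) → ℝ} (hf : Integrable f P) (y : Fin n → ℝ) :
    Integrable (fun x => f x * Lk a x y) P := by
  refine hf.mul_bdd (c := rexp (∑ j, y j ^ 2 / 2))
    ((Lk_meas a).comp measurable_prodMk_right).aestronglyMeasurable (ae_of_all _ fun x => ?_)
  rw [norm_of_nonneg (Lk_pos _ _ _).le]; exact Lk_le _ _ _

lemma pk_pos (y : Fin n → ℝ) : 0 < pk P a y := integral_exp_pos (Lk_int P a y)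

lemma pk_meas : Measurable (pk P a) :=
  (StronglyMeasurable.integral_prod_left' (Lk_meas a).stronglyMeasurable).measurable

lemma gk_meas (i : Fin n) : Measurable (gk P a i) := by
  refine (StronglyMeasurable.integral_prod_left' (μ := P)
    (f := fun z : (Fin n → ℝ) × (Fin n → ℝ) => z.1 i * Lk a z.1 z.2) ?_).measurable
  have := Lk_meas a
  exact Measurable.stronglyMeasurable (by fun_prop)

lemma pk_le (y : Fin n → ℝ) : pk P a y ≤ rexp (∑ j, y j ^ 2 / 2) := by
  have := integral_mono (Lk_int P a y) (integrable_const (rexp (∑ j, y j ^ 2 / 2)))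
    (fun x => Lk_le a x y)
  simpa [pk] using this

/-- Jensen lower bound. -/
lemma pk_ge (h1 : ∀ j, Integrable (fun x : Fin n → ℝ => x j) P)
    (h2 : ∀ j, Integrable (fun x : Fin n → ℝ => x j ^ 2) P) (y : Fin n → ℝ) :
    ∑ j, (a j * (∫ x, x j ∂P) * y j - a j ^ 2 * (∫ x, x j ^ 2 ∂P) / 2) ≤ log (pk P a y) := by
  set c := ∑ j, (a j * (∫ x, x j ∂P) * y j - a j ^ 2 * (∫ x, x j ^ 2 ∂P) / 2) with hc
  rw [le_log_iff_exp_le (pk_pos P a y)]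
  have hi : ∀ j, Integrable (fun x : Fin n → ℝ => a j * x j * y j - (a j * x j) ^ 2 / 2) P := by
    intro j
    refine ((((h1 j).const_mul (a j)).mul_const (y j)).sub
      ((h2 j).const_mul (a j ^ 2 / 2))).congr (ae_of_all _ fun x => ?_)
    simp only [Pi.sub_apply]; ring
  have hI : Integrable (fun x : Fin n → ℝ => ∑ j, (a j * x j * y j - (a j * x j) ^ 2 / 2)) P :=
    integrable_finsetSum _ fun j _ => hi j
  have hcI : ∫ x, ∑ j, (a j * x j * y j - (a j * x j) ^ 2 / 2) ∂P = c := by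
    rw [integral_finsetSum _ fun j _ => hi j, hc]
    refine Finset.sum_congr rfl fun j _ => ?_
    have e : ∀ x : Fin n → ℝ, a j * x j * y j - (a j * x j) ^ 2 / 2
        = (a j * y j) * x j - (a j ^ 2 / 2) * x j ^ 2 := fun x => by ring
    simp_rw [e]
    rw [integral_sub ((h1 j).const_mul _) ((h2 j).const_mul _), integral_const_mul,
      integral_const_mul]
    ring
  have hm : ∫ x, (rexp c * ((∑ j, (a j * x j * y j - (a j * x j) ^ 2 / 2)) - c) + rexp c) ∂P
      ≤ pk P a y := by
    refine integral_mono (((hI.sub (integrable_const c)).const_mul _).add (integrable_const _))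
      (Lk_int P a y) fun x => ?_
    simp only [Lk]
    set v := ∑ j, (a j * x j * y j - (a j * x j) ^ 2 / 2)
    have : rexp v = rexp c * rexp (v - c) := by rw [← exp_add]; congr 1; ring
    rw [this]
    nlinarith [add_one_le_exp (v - c), exp_pos c]
  have hI2 : Integrable (fun x : Fin n → ℝ =>
      rexp c * ((∑ j, (a j * x j * y j - (a j * x j) ^ 2 / 2)) - c)) P :=
    (hI.sub (integrable_const c)).const_mul _
  rw [integral_add hI2 (integrable_const _),
    integral_const_mul, integral_sub hI (integrable_const c), hcI] at hm
  simpa using hm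

end lik

/-! ### Transfer lemmas -/

lemma tr_int {α β : Type*} [MeasurableSpace α] [MeasurableSpace β] {μ : Measure α} {ν : Measure β}
    {T : α → β} (hT : Measurable T) {l : β → ℝ} (hl : Measurable l) (hl0 : ∀ z, 0 ≤ l z)
    (h : μ.map T = ν.withDensity (fun z => ENNReal.ofReal (l z))) {F : β → ℝ} (hF : Measurable F) :
    Integrable (fun ω => F (T ω)) μ ↔ Integrable (fun z => l z * F z) ν := by
  have h1 : Integrable (fun ω => F (T ω)) μ ↔ Integrable F (μ.map T) :=
    (integrable_map_measure hF.aestronglyMeasurable hT.aemeasurable).symm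
  rw [h1, h, integrable_withDensity_iff (by fun_prop) (ae_of_all _ fun z => ENNReal.ofReal_lt_top)]
  simp only [ENNReal.toReal_ofReal (hl0 _), mul_comm]

lemma tr_eq {α β : Type*} [MeasurableSpace α] [MeasurableSpace β] {μ : Measure α} {ν : Measure β}
    {T : α → β} (hT : Measurable T) {l : β → ℝ} (hl : Measurable l) (hl0 : ∀ z, 0 ≤ l z)
    (h : μ.map T = ν.withDensity (fun z => ENNReal.ofReal (l z))) {F : β → ℝ} (hF : Measurable F) :
    ∫ ω, F (T ω) ∂μ = ∫ z, l z * F z ∂ν := by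
  rw [← integral_map hT.aemeasurable hF.aestronglyMeasurable, h,
    integral_withDensity_eq_integral_toReal_smul (by fun_prop)
      (ae_of_all _ fun z => ENNReal.ofReal_lt_top)]
  simp only [ENNReal.toReal_ofReal (hl0 _), smul_eq_mul]

/-! ### One-dimensional entropy bounds -/

lemma exp_tilt (m : ℝ) : Integrable (fun t => rexp (m * t - m ^ 2 / 2)) g01 ∧
    ∫ t, rexp (m * t - m ^ 2 / 2) ∂g01 = 1 := by
  have h1 := (tr_int (μ := g01) (ν := g01) (T := fun t => m + t) (by fun_prop)
    (l := fun t => rexp (m * t - m ^ 2 / 2))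
    (by fun_prop) (fun _ => (exp_pos _).le) (g01_map_add m) (F := fun _ => 1) (by fun_prop)).1
    (integrable_const _)
  have h2 := tr_eq (μ := g01) (ν := g01) (T := fun t => m + t) (by fun_prop)
    (l := fun t => rexp (m * t - m ^ 2 / 2))
    (by fun_prop) (fun _ => (exp_pos _).le) (g01_map_add m) (F := fun _ => 1) (by fun_prop)
  simp at h1 h2
  exact ⟨h1, h2.symm⟩

lemma gibbs (f : ℝ → ℝ) (hf : ∀ t, 0 < f t) (hfi : Integrable f g01)
    (hft : Integrable (fun t => t * f t) g01)
    (hlog : Integrable (fun t => f t * log (f t)) g01) (A B : ℝ) (hA : ∫ t, f t ∂g01 = A)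
    (hA0 : 0 < A) (hB : ∫ t, t * f t ∂g01 = B) :
    1 / 2 * (B ^ 2 / A) ≤ ∫ t, f t * log (f t) ∂g01 - A * log A := by
  set m := B / A with hm
  obtain ⟨he, he1⟩ := exp_tilt m
  have hlow : Integrable (fun t => (log A - m ^ 2 / 2 + 1) * f t + m * (t * f t)
      - A * rexp (m * t - m ^ 2 / 2)) g01 :=
    ((hfi.const_mul _).add (hft.const_mul _)).sub (he.const_mul _)
  have hle : ∫ t, ((log A - m ^ 2 / 2 + 1) * f t + m * (t * f t)
      - A * rexp (m * t - m ^ 2 / 2)) ∂g01 ≤ ∫ t, f t * log (f t) ∂g01 := by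
    refine integral_mono hlow hlog fun t => ?_
    have hft := hf t
    set q := A * rexp (m * t - m ^ 2 / 2) with hq
    have hqpos : 0 < q := by positivity
    have hlq : log q = log A + (m * t - m ^ 2 / 2) := by
      rw [hq, log_mul hA0.ne' (exp_pos _).ne', log_exp]
    have h1 := log_le_sub_one_of_pos (div_pos hqpos hft)
    rw [log_div hqpos.ne' hft.ne', hlq] at h1
    have h2 := mul_le_mul_of_nonneg_left h1 hft.le
    have h3 : f t * (q / f t - 1) = q - f t := by field_simp
    rw [h3] at h2
    simp only
    nlinarith
  have e1 : ∫ t, ((log A - m ^ 2 / 2 + 1) * f t + m * (t * f t)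
      - A * rexp (m * t - m ^ 2 / 2)) ∂g01
      = (log A - m ^ 2 / 2 + 1) * A + m * B - A * 1 := by
    have i1 : Integrable (fun t => (log A - m ^ 2 / 2 + 1) * f t + m * (t * f t)) g01 :=
      (hfi.const_mul _).add (hft.const_mul _)
    rw [integral_sub i1 (he.const_mul _), integral_add (hfi.const_mul _) (hft.const_mul _),
      integral_const_mul, integral_const_mul, integral_const_mul, hA, hB, he1]
  rw [e1] at hle
  have : (log A - m ^ 2 / 2 + 1) * A + m * B - A * 1 = A * log A + 1 / 2 * (B ^ 2 / A) := by
    rw [hm]; field_simp; ring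
  linarith

lemma lsi' (f g : ℝ → ℝ) (hf : ∀ t, 0 < f t) (hd : ∀ t, HasDerivAt f (g t) t)
    (hg : Continuous g) (hfi : Integrable f g01) (A : ℝ) (hA : ∫ x, f x ∂g01 = A) (hA0 : 0 < A)
    (hft : Integrable (fun t => t * f t) g01)
    (hlog : Integrable (fun t => f t * log (f t)) g01)
    (hfis : Integrable (fun t => g t ^ 2 / f t) g01) :
    ∫ t, f t * log (f t) ∂g01 - A * log A ≤ 1 / 2 * ∫ t, g t ^ 2 / f t ∂g01 := by
  have hAi : (0:ℝ) < A⁻¹ := by positivity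
  have e1 : ∀ t, A⁻¹ * f t * log (A⁻¹ * f t) = A⁻¹ * (f t * log (f t)) - A⁻¹ * log A * f t := by
    intro t
    rw [log_mul hAi.ne' (hf t).ne', log_inv]; ring
  have e2 : ∀ t, (A⁻¹ * g t) ^ 2 / (A⁻¹ * f t) = A⁻¹ * (g t ^ 2 / f t) := by
    intro t
    have := (hf t).ne'
    field_simp
  have h := lsi (fun t => A⁻¹ * f t) (fun t => A⁻¹ * g t) (fun t => mul_pos hAi (hf t))
    (fun t => (hd t).const_mul _) (by fun_prop) (hfi.const_mul _)
    (by rw [integral_const_mul, hA]; field_simp)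
    ((hft.const_mul A⁻¹).congr (ae_of_all _ fun t => by simp only; ring))
    (by simp_rw [e1]; exact (hlog.const_mul _).sub (hfi.const_mul _))
    (by simp_rw [e2]; exact hfis.const_mul _)
  simp_rw [e1, e2] at h
  rw [integral_sub (hlog.const_mul _) (hfi.const_mul _), integral_const_mul, integral_const_mul,
    integral_const_mul, hA] at h
  have h' := mul_le_mul_of_nonneg_left h hA0.le
  have e3 : A * (A⁻¹ * ∫ t, f t * log (f t) ∂g01 - A⁻¹ * log A * A)
    = ∫ t, f t * log (f t) ∂g01 - A * log A := by field_simp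
  have e4 : A * (1 / 2 * (A⁻¹ * ∫ t, g t ^ 2 / f t ∂g01)) = 1 / 2 * ∫ t, g t ^ 2 / f t ∂g01 := by
    field_simp
  rw [← integral_const_mul] at h'
  rw [integral_const_mul, e3] at h'
  linarith

section step
variable {n : ℕ} (P : Measure (Fin n → ℝ)) [IsProbabilityMeasure P] (a : Fin n → ℝ) (i : Fin n)
  (s : ℝ)

lemma Lk_update (ha : a i = 0) (x y : Fin n → ℝ) (t : ℝ) :
    Lk (Function.update a i s) x (Function.update y i t)
      = Lk a x y * rexp (s * x i * t - (s * x i) ^ 2 / 2) := by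
  unfold Lk
  rw [← exp_add, ← Finset.add_sum_erase _ _ (Finset.mem_univ i),
    ← Finset.add_sum_erase Finset.univ (fun j => a j * x j * y j - (a j * x j) ^ 2 / 2)
      (Finset.mem_univ i)]
  have : ∑ j ∈ Finset.univ.erase i, (Function.update a i s j * x j * Function.update y i t j
      - (Function.update a i s j * x j) ^ 2 / 2)
      = ∑ j ∈ Finset.univ.erase i, (a j * x j * y j - (a j * x j) ^ 2 / 2) := by
    refine Finset.sum_congr rfl fun j hj => ?_
    rw [Function.update_of_ne (Finset.ne_of_mem_erase hj),
      Function.update_of_ne (Finset.ne_of_mem_erase hj)]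
  rw [this]
  simp [ha]
  ring

lemma exp_bd (v t t0 : ℝ) (ht : t ∈ Metric.ball t0 1) :
    rexp (v * t - v ^ 2 / 2) ≤ rexp ((|t0| + 1) ^ 2 / 2) := by
  refine exp_le_exp.2 ?_
  have h1 : |t| ≤ |t0| + 1 := by
    rw [Metric.mem_ball, dist_eq] at ht
    have := abs_sub_abs_le_abs_sub t t0
    linarith
  have h2 : t ^ 2 ≤ (|t0| + 1) ^ 2 := by rw [← sq_abs t]; gcongr
  nlinarith [sq_nonneg (v - t)]

lemma step_deriv (ha : a i = 0) (h1 : ∀ j, Integrable (fun x : Fin n → ℝ => x j) P)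
    (y : Fin n → ℝ) (t0 : ℝ) :
    HasDerivAt (fun t => pk P (Function.update a i s) (Function.update y i t))
      (s * gk P (Function.update a i s) i (Function.update y i t0)) t0 := by
  have hbi : Integrable (fun x : Fin n → ℝ =>
      |s| * rexp ((|t0| + 1) ^ 2 / 2) * (|x i| * Lk a x y)) P :=
    (xLk_int P a (h1 i).abs y).const_mul _
  have := (hasDerivAt_integral_of_dominated_loc_of_deriv_le (μ := P)
    (F := fun t x => Lk a x y * rexp (s * x i * t - (s * x i) ^ 2 / 2))
    (F' := fun t x => Lk a x y * (rexp (s * x i * t - (s * x i) ^ 2 / 2) * (s * x i)))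
    (x₀ := t0) (s := Metric.ball t0 1)
    (bound := fun x => |s| * rexp ((|t0| + 1) ^ 2 / 2) * (|x i| * Lk a x y))
    (Metric.ball_mem_nhds t0 one_pos) ?_ ?_ ?_ ?_ hbi ?_).2
  · simp only [pk, Lk_update a i s ha, gk]
    convert! this using 1
    rw [← integral_const_mul]
    exact integral_congr_ae (ae_of_all _ fun x => by simp only; ring)
  · refine Eventually.of_forall fun t => Measurable.aestronglyMeasurable ?_
    have := (Lk_meas a).comp (measurable_prodMk_right (y := y))
    simp only [Function.comp_def] at this
    fun_prop
  · have := Lk_int P (Function.update a i s) (Function.update y i t0)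
    simpa only [Lk_update a i s ha] using this
  · refine Measurable.aestronglyMeasurable ?_
    have := (Lk_meas a).comp (measurable_prodMk_right (y := y))
    simp only [Function.comp_def] at this
    fun_prop
  · refine ae_of_all _ fun x t ht => ?_
    rw [norm_mul, norm_mul, norm_of_nonneg (Lk_pos _ _ _).le, norm_of_nonneg (exp_pos _).le,
      norm_mul, norm_eq_abs, norm_eq_abs]
    have := exp_bd (s * x i) t t0 ht
    have hL := (Lk_pos a x y).le
    calc _ = |s| * rexp (s * x i * t - (s * x i) ^ 2 / 2) * (|x i| * Lk a x y) := by ring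
      _ ≤ _ := by gcongr
  · refine ae_of_all _ fun x t _ => ?_
    have h : HasDerivAt (fun t => s * x i * t - (s * x i) ^ 2 / 2) (s * x i) t := by
      simpa using ((hasDerivAt_id t).const_mul (s * x i)).sub_const ((s * x i) ^ 2 / 2)
    exact h.exp.const_mul _

lemma step_cont (ha : a i = 0) (h1 : ∀ j, Integrable (fun x : Fin n → ℝ => x j) P)
    (y : Fin n → ℝ) :
    Continuous (fun t => gk P (Function.update a i s) i (Function.update y i t)) := by
  refine continuous_iff_continuousAt.2 fun t0 => ?_
  simp only [gk, Lk_update a i s ha]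
  refine continuousAt_of_dominated
    (bound := fun x => rexp ((|t0| + 1) ^ 2 / 2) * (|x i| * Lk a x y)) ?_ ?_ ?_ ?_
  · refine Eventually.of_forall fun t => Measurable.aestronglyMeasurable ?_
    have := (Lk_meas a).comp (measurable_prodMk_right (y := y))
    simp only [Function.comp_def] at this
    fun_prop
  · filter_upwards [Metric.ball_mem_nhds t0 one_pos] with t ht
    refine ae_of_all _ fun x => ?_
    rw [norm_mul, norm_mul, norm_of_nonneg (Lk_pos _ _ _).le, norm_of_nonneg (exp_pos _).le,
      norm_eq_abs]
    have := exp_bd (s * x i) t t0 ht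
    have hL := (Lk_pos a x y).le
    calc _ = rexp (s * x i * t - (s * x i) ^ 2 / 2) * (|x i| * Lk a x y) := by ring
      _ ≤ _ := by gcongr
  · exact (xLk_int P a (h1 i).abs y).const_mul _
  · exact ae_of_all _ fun x => by fun_prop

lemma step_fubini (ha : a i = 0) (h1 : ∀ j, Integrable (fun x : Fin n → ℝ => x j) P)
    (y : Fin n → ℝ) :
    Integrable (fun t => pk P (Function.update a i s) (Function.update y i t)) g01 ∧
    ∫ t, pk P (Function.update a i s) (Function.update y i t) ∂g01 = pk P a y ∧
    Integrable (fun t => t * pk P (Function.update a i s) (Function.update y i t)) g01 ∧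
    ∫ t, t * pk P (Function.update a i s) (Function.update y i t) ∂g01 = s * gk P a i y := by
  have hlaw := map_prod_withDensity P g01 (fun x t => s * x i + t)
    (fun x t => ENNReal.ofReal (rexp (s * x i * t - (s * x i) ^ 2 / 2)))
    (by simp only [Function.uncurry_def]; fun_prop) (by simp only [Function.uncurry_def]; fun_prop)
    (fun x => g01_map_add (s * x i))
  have hLm : Measurable (fun x => Lk a x y) := (Lk_meas a).comp (measurable_prodMk_right (y := y))
  have hTm : Measurable (fun z : (Fin n → ℝ) × ℝ => (z.1, s * z.1 i + z.2)) := by fun_prop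
  have hlm : Measurable (fun z : (Fin n → ℝ) × ℝ =>
      rexp (s * z.1 i * z.2 - (s * z.1 i) ^ 2 / 2)) := by fun_prop
  have F1m : Measurable (fun z : (Fin n → ℝ) × ℝ => Lk a z.1 y) := by fun_prop
  have F2m : Measurable (fun z : (Fin n → ℝ) × ℝ => z.2 * Lk a z.1 y) := by fun_prop
  have hid : Integrable (fun t : ℝ => t) g01 :=
    (memLp_id_gaussianReal' 1 (by simp)).integrable le_rfl
  -- shifted integrability
  have I1 : Integrable (fun z : (Fin n → ℝ) × ℝ => Lk a z.1 y) (P.prod g01) :=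
    (Lk_int P a y).comp_fst g01
  have I2a : Integrable (fun z : (Fin n → ℝ) × ℝ => s * (z.1 i * Lk a z.1 y)) (P.prod g01) :=
    ((xLk_int P a (h1 i) y).comp_fst g01).const_mul s
  have I2b : Integrable (fun z : (Fin n → ℝ) × ℝ => Lk a z.1 y * z.2) (P.prod g01) :=
    (Lk_int P a y).mul_prod hid
  have I2 : Integrable (fun z : (Fin n → ℝ) × ℝ => (s * z.1 i + z.2) * Lk a z.1 y) (P.prod g01) :=
    (I2a.add I2b).congr (ae_of_all _ fun z => by simp only [Pi.add_apply]; ring)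
  have J1 := (tr_int hTm hlm (fun _ => (exp_pos _).le) hlaw F1m).1 I1
  have J2 := (tr_int hTm hlm (fun _ => (exp_pos _).le) hlaw F2m).1 I2
  have E1 := tr_eq hTm hlm (fun _ => (exp_pos _).le) hlaw F1m
  have E2 := tr_eq hTm hlm (fun _ => (exp_pos _).le) hlaw F2m
  simp only at J1 J2 E1 E2
  have e1 : ∀ t, ∫ x, rexp (s * x i * t - (s * x i) ^ 2 / 2) * Lk a x y ∂P
      = pk P (Function.update a i s) (Function.update y i t) := fun t => by
    simp only [pk, Lk_update a i s ha]
    exact integral_congr_ae (ae_of_all _ fun x => by simp only; ring)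
  have e2 : ∀ t, ∫ x, rexp (s * x i * t - (s * x i) ^ 2 / 2) * (t * Lk a x y) ∂P
      = t * pk P (Function.update a i s) (Function.update y i t) := fun t => by
    rw [← e1 t, ← integral_const_mul]
    exact integral_congr_ae (ae_of_all _ fun x => by simp only; ring)
  have K1 := J1.integral_prod_right
  have K2 := J2.integral_prod_right
  simp only [e1, e2] at K1 K2
  refine ⟨K1, ?_, K2, ?_⟩
  · rw [integral_prod_symm _ J1] at E1
    simp only [e1] at E1
    rw [← E1, integral_prod _ I1]
    simp [pk]
  · rw [integral_prod_symm _ J2] at E2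
    simp only [e2] at E2
    rw [← E2]
    have : ∀ z : (Fin n → ℝ) × ℝ, (s * z.1 i + z.2) * Lk a z.1 y
        = s * (z.1 i * Lk a z.1 y) + Lk a z.1 y * z.2 := fun z => by ring
    simp_rw [this]
    rw [integral_add I2a I2b, integral_prod_mul (fun x => Lk a x y) (fun t : ℝ => t),
      integral_const_mul, integral_fun_fst (fun x : Fin n → ℝ => x i * Lk a x y)]
    simp [gk, integral_id_gaussianReal]

end step

lemma step_int {n : ℕ} (P : Measure (Fin n → ℝ)) [IsProbabilityMeasure P] (a : Fin n → ℝ)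
    (i : Fin n) (s : ℝ) (ha : a i = 0) (h1 : ∀ j, Integrable (fun x : Fin n → ℝ => x j) P)
    (hl : Integrable (fun y => pk P a y * log (pk P a y)) (Gn n))
    (hl' : Integrable (fun y => pk P (Function.update a i s) y
      * log (pk P (Function.update a i s) y)) (Gn n))
    (hg : Integrable (fun y => gk P a i y ^ 2 / pk P a y) (Gn n))
    (hg' : Integrable (fun y => gk P (Function.update a i s) i y ^ 2
      / pk P (Function.update a i s) y) (Gn n)) :
    s ^ 2 / 2 * ∫ y, gk P a i y ^ 2 / pk P a y ∂(Gn n)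
      ≤ ∫ y, pk P (Function.update a i s) y * log (pk P (Function.update a i s) y) ∂(Gn n)
        - ∫ y, pk P a y * log (pk P a y) ∂(Gn n) ∧
    ∫ y, pk P (Function.update a i s) y * log (pk P (Function.update a i s) y) ∂(Gn n)
        - ∫ y, pk P a y * log (pk P a y) ∂(Gn n)
      ≤ s ^ 2 / 2 * ∫ y, gk P (Function.update a i s) i y ^ 2
        / pk P (Function.update a i s) y ∂(Gn n) := by
  set a' := Function.update a i s with ha'
  have hu := update_mp i
  have key : ∀ F : (Fin n → ℝ) → ℝ, Integrable F (Gn n) →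
      Integrable (fun z : (Fin n → ℝ) × ℝ => F (Function.update z.1 i z.2)) ((Gn n).prod g01) ∧
      ∫ y, F y ∂(Gn n) = ∫ y, ∫ t, F (Function.update y i t) ∂g01 ∂(Gn n) := by
    intro F hF
    have hi : Integrable (fun z : (Fin n → ℝ) × ℝ => F (Function.update z.1 i z.2))
        ((Gn n).prod g01) := hu.integrable_comp_of_integrable hF
    refine ⟨hi, ?_⟩
    rw [← integral_prod _ hi]
    conv_lhs => rw [← hu.map_eq]
    rw [integral_map hu.measurable.aemeasurable]
    rw [hu.map_eq]; exact hF.aestronglyMeasurable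
  obtain ⟨i1, e1⟩ := key _ hl'
  obtain ⟨i2, e2⟩ := key _ hg'
  rw [e1, e2, ← integral_sub i1.integral_prod_left hl, ← integral_const_mul, ← integral_const_mul]
  have a1 := i1.prod_right_ae
  have a2 := i2.prod_right_ae
  constructor
  · refine integral_mono_ae (hg.const_mul _) (i1.integral_prod_left.sub hl) ?_
    filter_upwards [a1] with y hy
    obtain ⟨f1, f2, f3, f4⟩ := step_fubini P a i s ha h1 y
    have := gibbs _ (fun t => pk_pos P a' (Function.update y i t)) f1 f3 hy _ _ f2
      (pk_pos P a y) f4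
    refine le_trans (le_of_eq ?_) this
    ring
  · refine integral_mono_ae (i1.integral_prod_left.sub hl) (i2.integral_prod_left.const_mul _) ?_
    filter_upwards [a1, a2] with y hy hy2
    obtain ⟨f1, f2, f3, f4⟩ := step_fubini P a i s ha h1 y
    have e : ∀ t, (s * gk P a' i (Function.update y i t)) ^ 2 / pk P a' (Function.update y i t)
        = s ^ 2 * (gk P a' i (Function.update y i t) ^ 2 / pk P a' (Function.update y i t)) :=
      fun t => by ring
    have := lsi' _ _ (fun t => pk_pos P a' (Function.update y i t))
      (fun t => step_deriv P a i s ha h1 y t) ((step_cont P a i s ha h1 y).const_mul s) f1 _ f2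
      (pk_pos P a y) f3 hy (by simp_rw [← ha', e]; exact hy2.const_mul _)
    refine this.trans (le_of_eq ?_)
    simp_rw [← ha', e]
    rw [integral_const_mul]
    ring

section channel
variable {Ω : Type*} [MeasurableSpace Ω] (μ : Measure Ω) [IsProbabilityMeasure μ]
    {n : ℕ} (X N : Ω → Fin n → ℝ)
    (hX : Measurable X) (hN : Measurable N)
    (hXN : IndepFun X N μ)
    (hN_law : μ.map N = Measure.pi fun _ : Fin n => gaussianReal 0 1)
    (hX2 : Integrable (fun ω => ∑ i, X ω i ^ 2) μ)

def Ya (X N : Ω → Fin n → ℝ) (a : Fin n → ℝ) : Ω → Fin n → ℝ := fun ω j => a j * X ω j + N ω j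

include hX hN in
omit [IsProbabilityMeasure μ] in
lemma Ya_meas (a : Fin n → ℝ) : Measurable (Ya X N a) := by
  unfold Ya; fun_prop

include hX hN hXN hN_law in
lemma joint_law (a : Fin n → ℝ) : μ.map (fun ω => (X ω, Ya X N a ω))
    = ((μ.map X).prod (Gn n)).withDensity (fun z => ENNReal.ofReal (Lk a z.1 z.2)) := by
  have hi := (indepFun_iff_map_prod_eq_prod_map_map hX.aemeasurable hN.aemeasurable).1 hXN
  rw [hN_law] at hi
  have := map_prod_withDensity (μ.map X) (Gn n) (fun x y => (fun j => a j * x j) + y)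
    (fun x y => ENNReal.ofReal (Lk a x y))
    (by simp only [Function.uncurry_def]; fun_prop)
    (by simp only [Function.uncurry_def]; exact (Lk_meas a).ennreal_ofReal)
    (fun x => Gn_map_add (fun j => a j * x j))
  rw [← hi, Measure.map_map (by fun_prop) (by fun_prop), hi] at this
  exact this

include hX hN hXN hN_law in
lemma marg_law (a : Fin n → ℝ) : μ.map (Ya X N a)
    = (Gn n).withDensity (fun y => ENNReal.ofReal (pk (μ.map X) a y)) := by
  have : IsProbabilityMeasure (μ.map X) := Measure.isProbabilityMeasure_map hX.aemeasurable
  have hY := Ya_meas X N hX hN a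
  have h := joint_law μ X N hX hN hXN hN_law a
  have h2 : μ.map (Ya X N a) = (μ.map (fun ω => (X ω, Ya X N a ω))).map Prod.snd := by
    rw [Measure.map_map measurable_snd (hX.prodMk hY)]; rfl
  rw [h2, h]
  have hLm := (Lk_meas a).ennreal_ofReal
  ext A hA
  rw [Measure.map_apply measurable_snd hA, withDensity_apply _ (measurable_snd hA),
    withDensity_apply _ hA, ← lintegral_indicator (measurable_snd hA), ← lintegral_indicator hA,
    lintegral_prod_symm _ (hLm.indicator (measurable_snd hA)).aemeasurable]
  refine lintegral_congr fun y => ?_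
  by_cases hy : y ∈ A
  · rw [Set.indicator_of_mem hy, pk, ofReal_integral_eq_lintegral_ofReal (Lk_int _ a y)
      (ae_of_all _ fun x => (Lk_pos a x y).le)]
    refine lintegral_congr fun x => ?_
    rw [Set.indicator_of_mem (by exact hy)]
  · rw [Set.indicator_of_notMem hy]
    refine lintegral_eq_zero_of_ae_eq_zero (ae_of_all _ fun x => ?_)
    exact Set.indicator_of_notMem (by exact hy) _

include hX hX2 in
omit [IsProbabilityMeasure μ] in
lemma X_sq (j : Fin n) : Integrable (fun ω => X ω j ^ 2) μ := by
  refine hX2.mono' (by fun_prop) (ae_of_all _ fun ω => ?_)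
  rw [norm_of_nonneg (sq_nonneg _)]
  exact Finset.single_le_sum (f := fun i => X ω i ^ 2) (fun _ _ => sq_nonneg _) (Finset.mem_univ j)

include hX hX2 in
omit [IsProbabilityMeasure μ] in
lemma X_memLp (j : Fin n) : MemLp (fun ω => X ω j) 2 μ :=
  (memLp_two_iff_integrable_sq (by fun_prop)).2 (X_sq μ X hX hX2 j)

include hN hN_law in
omit [IsProbabilityMeasure μ] in
lemma N_memLp (j : Fin n) : MemLp (fun ω => N ω j) 2 μ ∧ ∫ ω, N ω j ∂μ = 0 := by
  have h : MeasurePreserving (fun ω => N ω j) μ g01 :=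
    (measurePreserving_eval (fun _ : Fin n => gaussianReal 0 1) j).comp ⟨hN, hN_law⟩
  constructor
  · exact (memLp_id_gaussianReal' 2 (by simp)).comp_measurePreserving h
  · have h2 : ∫ t, t ∂(μ.map (fun ω => N ω j)) = ∫ ω, N ω j ∂μ :=
      integral_map (by fun_prop) (by fun_prop)
    rw [← h2, h.map_eq, integral_id_gaussianReal]

include hX hN hN_law hX2 in
omit [IsProbabilityMeasure μ] in
lemma Ya_memLp (a : Fin n → ℝ) (j : Fin n) : MemLp (fun ω => Ya X N a ω j) 2 μ :=
  ((X_memLp μ X hX hX2 j).const_mul (a j)).add (N_memLp μ N hN hN_law j).1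

include hX hX2 in
lemma P_int (j : Fin n) : Integrable (fun x : Fin n → ℝ => x j) (μ.map X) ∧
    Integrable (fun x : Fin n → ℝ => x j ^ 2) (μ.map X) := by
  constructor
  · rw [integrable_map_measure (measurable_pi_apply j).aestronglyMeasurable hX.aemeasurable]
    exact (X_memLp μ X hX hX2 j).integrable (by simp)
  · rw [integrable_map_measure ((measurable_pi_apply j).pow_const 2).aestronglyMeasurable
      hX.aemeasurable]
    exact X_sq μ X hX hX2 j

include hX hN hN_law hX2 in
lemma log_int (a : Fin n → ℝ) : Integrable (fun ω => log (pk (μ.map X) a (Ya X N a ω))) μ := by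
  have : IsProbabilityMeasure (μ.map X) := Measure.isProbabilityMeasure_map hX.aemeasurable
  have hY := Ya_meas X N hX hN a
  have hY2 := fun j => Ya_memLp μ X N hX hN hN_law hX2 a j
  have hb1 : Integrable (fun ω => ∑ j, Ya X N a ω j ^ 2 / 2) μ :=
    integrable_finsetSum _ fun j _ => ((hY2 j).integrable_sq).div_const 2
  have hb2 : Integrable (fun ω => ∑ j, (a j * (∫ x, x j ∂(μ.map X)) * Ya X N a ω j
      - a j ^ 2 * (∫ x, x j ^ 2 ∂(μ.map X)) / 2)) μ :=
    integrable_finsetSum _ fun j _ =>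
      (((hY2 j).integrable (by simp)).const_mul _).sub (integrable_const _)
  refine (hb1.abs.add hb2.abs).mono'
    ((pk_meas _ a).comp hY).log.aestronglyMeasurable (ae_of_all _ fun ω => ?_)
  have u := log_le_log (pk_pos _ _ _) (pk_le (μ.map X) a (Ya X N a ω))
  rw [log_exp] at u
  have l := pk_ge (μ.map X) a (fun j => (P_int μ X hX hX2 j).1) (fun j => (P_int μ X hX hX2 j).2)
    (Ya X N a ω)
  simp only [Pi.add_apply, norm_eq_abs]
  rw [abs_le]
  set A := ∑ j, Ya X N a ω j ^ 2 / 2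
  set B := ∑ j, (a j * (∫ x, x j ∂(μ.map X)) * Ya X N a ω j
      - a j ^ 2 * (∫ x, x j ^ 2 ∂(μ.map X)) / 2)
  constructor
  · linarith [neg_abs_le B, abs_nonneg A]
  · linarith [le_abs_self A, abs_nonneg B]

include hX hN hXN hN_law hX2 in
lemma ent_int (a : Fin n → ℝ) :
    Integrable (fun y => pk (μ.map X) a y * log (pk (μ.map X) a y)) (Gn n) ∧
    ∫ ω, log (pk (μ.map X) a (Ya X N a ω)) ∂μ
      = ∫ y, pk (μ.map X) a y * log (pk (μ.map X) a y) ∂(Gn n) := by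
  have : IsProbabilityMeasure (μ.map X) := Measure.isProbabilityMeasure_map hX.aemeasurable
  have hm := marg_law μ X N hX hN hXN hN_law a
  have hY := Ya_meas X N hX hN a
  exact ⟨(tr_int hY (pk_meas _ a) (fun y => (pk_pos _ a y).le) hm (pk_meas _ a).log).1
    (log_int μ X N hX hN hN_law hX2 a),
    tr_eq hY (pk_meas _ a) (fun y => (pk_pos _ a y).le) hm (pk_meas _ a).log⟩

/-- posterior mean -/
def Mk (P : Measure (Fin n → ℝ)) (a : Fin n → ℝ) (i : Fin n) (y : Fin n → ℝ) : ℝ :=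
  gk P a i y / pk P a y

include hX hN hXN hN_law hX2 in
lemma bayes (a : Fin n → ℝ) (i : Fin n) (F : (Fin n → ℝ) → ℝ) (hF : Measurable F)
    (h : Integrable (fun ω => F (Ya X N a ω) * X ω i) μ) :
    Integrable (fun ω => F (Ya X N a ω) * Mk (μ.map X) a i (Ya X N a ω)) μ ∧
    ∫ ω, F (Ya X N a ω) * Mk (μ.map X) a i (Ya X N a ω) ∂μ = ∫ ω, F (Ya X N a ω) * X ω i ∂μ := by
  have : IsProbabilityMeasure (μ.map X) := Measure.isProbabilityMeasure_map hX.aemeasurable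
  have hY := Ya_meas X N hX hN a
  have hj := joint_law μ X N hX hN hXN hN_law a
  have hm := marg_law μ X N hX hN hXN hN_law a
  have hG : Measurable (fun z : (Fin n → ℝ) × (Fin n → ℝ) => F z.2 * z.1 i) := by fun_prop
  have hM : Measurable (fun y => F y * Mk (μ.map X) a i y) :=
    hF.mul ((gk_meas _ a i).div (pk_meas _ a))
  have J := (tr_int (hX.prodMk hY) (Lk_meas a) (fun z => (Lk_pos a z.1 z.2).le) hj hG).1 h
  have E := tr_eq (hX.prodMk hY) (Lk_meas a) (fun z => (Lk_pos a z.1 z.2).le) hj hG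
  have e : ∀ y, ∫ x, Lk a x y * (F y * x i) ∂(μ.map X)
      = pk (μ.map X) a y * (F y * Mk (μ.map X) a i y) := by
    intro y
    have := (pk_pos (μ.map X) a y).ne'
    have e1 : pk (μ.map X) a y * (F y * Mk (μ.map X) a i y) = F y * gk (μ.map X) a i y := by
      unfold Mk; field_simp
    rw [e1, gk, ← integral_const_mul]
    exact integral_congr_ae (ae_of_all _ fun x => by simp only; ring)
  have K := J.integral_prod_right
  simp only at K E
  simp only [e] at K
  refine ⟨(tr_int hY (pk_meas _ a) (fun y => (pk_pos _ a y).le) hm hM).2 K, ?_⟩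
  rw [tr_eq hY (pk_meas _ a) (fun y => (pk_pos _ a y).le) hm hM, E, integral_prod_symm _ J]
  simp only [e]

lemma Lk_congr (a x y y' : Fin n → ℝ) (h : ∀ j, a j ≠ 0 → y j = y' j) : Lk a x y = Lk a x y' := by
  unfold Lk
  congr 1
  refine Finset.sum_congr rfl fun j _ => ?_
  by_cases hj : a j = 0
  · simp [hj]
  · rw [h j hj]

include hX hN hXN hN_law hX2 in
lemma condExp_eq (a : Fin n → ℝ) (i : Fin n) (Y : Ω → Fin n → ℝ) (hY0 : Measurable Y)
    (m : ℕ) (hmn : m ≤ n)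
    (ha : ∀ j : Fin n, m ≤ j.1 → a j = 0)
    (hYa : ∀ ω, ∀ j : Fin n, j.1 < m → Y ω j = Ya X N a ω j) :
    (fun ω => Mk (μ.map X) a i (Ya X N a ω)) =ᵐ[μ] μ[fun ω => X ω i | obsSigma Y m hmn] := by
  have : IsProbabilityMeasure (μ.map X) := Measure.isProbabilityMeasure_map hX.aemeasurable
  have hY := Ya_meas X N hX hN a
  have hXi : Integrable (fun ω => X ω i) μ := (X_memLp μ X hX hX2 i).integrable (by simp)
  have hle : obsSigma Y m hmn ≤ ‹MeasurableSpace Ω› := by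
    refine Measurable.comap_le ?_
    fun_prop
  have hMm : Measurable (Mk (μ.map X) a i) := (gk_meas _ a i).div (pk_meas _ a)
  have hMi : Integrable (fun ω => Mk (μ.map X) a i (Ya X N a ω)) μ := by
    have := (bayes μ X N hX hN hXN hN_law hX2 a i (fun _ => 1) (by fun_prop) (by simpa using hXi)).1
    simpa using this
  refine ae_eq_condExp_of_forall_setIntegral_eq hle hXi (fun s _ _ => hMi.integrableOn) ?_ ?_
  · rintro s ⟨B, hB, rfl⟩ -
    set B' : Set (Fin n → ℝ) := (fun y => fun j : Fin m => y (Fin.castLE hmn j)) ⁻¹' B with hB'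
    have hB'm : MeasurableSet B' := by
      refine hB.preimage ?_
      fun_prop
    have hs : (fun ω => fun j : Fin m => Y ω (Fin.castLE hmn j)) ⁻¹' B = Ya X N a ⁻¹' B' := by
      ext ω
      simp only [hB', Set.mem_preimage]
      have : (fun j : Fin m => Y ω (Fin.castLE hmn j))
          = fun j : Fin m => Ya X N a ω (Fin.castLE hmn j) :=
        funext fun j => hYa ω _ j.2
      rw [this]
    rw [hs, ← integral_indicator (hY hB'm), ← integral_indicator (hY hB'm)]
    have e : ∀ G : Ω → ℝ, (Ya X N a ⁻¹' B').indicator G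
        = fun ω => B'.indicator (fun _ => (1:ℝ)) (Ya X N a ω) * G ω := by
      intro G
      funext ω
      by_cases hω : Ya X N a ω ∈ B'
      · rw [Set.indicator_of_mem (by exact hω), Set.indicator_of_mem hω, one_mul]
      · rw [Set.indicator_of_notMem (by exact hω), Set.indicator_of_notMem hω, zero_mul]
    rw [e, e]
    refine (bayes μ X N hX hN hXN hN_law hX2 a i (B'.indicator fun _ => 1)
      (measurable_const.indicator hB'm) ?_).2
    rw [← e (fun ω => X ω i)]
    exact hXi.indicator (hY hB'm)
  · refine StronglyMeasurable.aestronglyMeasurable ?_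
    refine Measurable.stronglyMeasurable ?_
    set ext : (Fin m → ℝ) → (Fin n → ℝ) := fun v j => if h : j.1 < m then v ⟨j.1, h⟩ else 0 with hext
    have hextm : Measurable ext := by
      refine measurable_pi_iff.2 fun j => ?_
      by_cases h : j.1 < m
      · simp only [hext, h, dite_true]; fun_prop
      · simp only [hext, h, dite_false]; fun_prop
    have e : (fun ω => Mk (μ.map X) a i (Ya X N a ω)) = (Mk (μ.map X) a i ∘ ext) ∘
        (fun ω => fun j : Fin m => Y ω (Fin.castLE hmn j)) := by
      funext ω
      have hc : ∀ x, Lk a x (Ya X N a ω)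
          = Lk a x (ext (fun j : Fin m => Y ω (Fin.castLE hmn j))) := by
        intro x
        refine Lk_congr a x _ _ fun j hj => ?_
        have hjm : j.1 < m := by
          by_contra hcon
          exact hj (ha j (not_lt.1 hcon))
        simp only [hext, hjm, dite_true]
        exact (hYa ω j hjm).symm
      simp only [Function.comp, Mk, gk, pk, hc]
    rw [e]
    exact (hMm.comp hextm).comp (comap_measurable _)

include hX hN hXN hN_law hX2 in
lemma mmse_eq (a : Fin n → ℝ) (i : Fin n) (Y : Ω → Fin n → ℝ) (hY0 : Measurable Y)
    (m : ℕ) (hmn : m ≤ n)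
    (ha : ∀ j : Fin n, m ≤ j.1 → a j = 0)
    (hYa : ∀ ω, ∀ j : Fin n, j.1 < m → Y ω j = Ya X N a ω j) :
    Integrable (fun y => gk (μ.map X) a i y ^ 2 / pk (μ.map X) a y) (Gn n) ∧
    ∫ ω, (X ω i - (μ[fun ω' => X ω' i | obsSigma Y m hmn]) ω) ^ 2 ∂μ
      = ∫ ω, X ω i ^ 2 ∂μ - ∫ y, gk (μ.map X) a i y ^ 2 / pk (μ.map X) a y ∂(Gn n) := by
  have : IsProbabilityMeasure (μ.map X) := Measure.isProbabilityMeasure_map hX.aemeasurable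
  have hY := Ya_meas X N hX hN a
  have hX2i := X_memLp μ X hX hX2 i
  have hce := condExp_eq μ X N hX hN hXN hN_law hX2 a i Y hY0 m hmn ha hYa
  have hMm : Measurable (Mk (μ.map X) a i) := (gk_meas _ a i).div (pk_meas _ a)
  have hM2 : MemLp (fun ω => Mk (μ.map X) a i (Ya X N a ω)) 2 μ :=
    (memLp_congr_ae hce).2 (hX2i.condExp one_le_two)
  have hMX : Integrable (fun ω => Mk (μ.map X) a i (Ya X N a ω) * X ω i) μ :=
    hM2.integrable_mul hX2i
  obtain ⟨hMM, hE⟩ := bayes μ X N hX hN hXN hN_law hX2 a i _ hMm hMX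
  have hm := marg_law μ X N hX hN hXN hN_law a
  have hsqm : Measurable (fun y => Mk (μ.map X) a i y * Mk (μ.map X) a i y) := hMm.mul hMm
  have e : ∀ y, pk (μ.map X) a y * (Mk (μ.map X) a i y * Mk (μ.map X) a i y)
      = gk (μ.map X) a i y ^ 2 / pk (μ.map X) a y := by
    intro y
    have := (pk_pos (μ.map X) a y).ne'
    unfold Mk; field_simp
  have J := (tr_int hY (pk_meas _ a) (fun y => (pk_pos _ a y).le) hm hsqm).1 hMM
  have E := tr_eq hY (pk_meas _ a) (fun y => (pk_pos _ a y).le) hm hsqm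
  simp only [e] at J E
  refine ⟨J, ?_⟩
  rw [← E]
  have h1 : ∫ ω, (X ω i - (μ[fun ω' => X ω' i | obsSigma Y m hmn]) ω) ^ 2 ∂μ
      = ∫ ω, ((X ω i ^ 2 - 2 * (Mk (μ.map X) a i (Ya X N a ω) * X ω i))
        + Mk (μ.map X) a i (Ya X N a ω) * Mk (μ.map X) a i (Ya X N a ω)) ∂μ := by
    refine integral_congr_ae ?_
    filter_upwards [hce] with ω hω
    rw [← hω]; ring
  have hS := X_sq μ X hX hX2 i
  have i1 : Integrable (fun ω => X ω i ^ 2 - 2 * (Mk (μ.map X) a i (Ya X N a ω) * X ω i)) μ :=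
    hS.sub (hMX.const_mul 2)
  rw [h1, integral_add i1 hMM, integral_sub hS (hMX.const_mul 2), integral_const_mul, ← hE]
  ring

include hX hN hXN hN_law hX2 in
lemma mutualInfo_eq (a : Fin n → ℝ) :
    mutualInfo μ X (Ya X N a) = ENNReal.ofReal (∑ j, a j ^ 2 / 2 * ∫ ω, X ω j ^ 2 ∂μ
      - ∫ y, pk (μ.map X) a y * log (pk (μ.map X) a y) ∂(Gn n)) := by
  have : IsProbabilityMeasure (μ.map X) := Measure.isProbabilityMeasure_map hX.aemeasurable
  have hY := Ya_meas X N hX hN a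
  have : IsProbabilityMeasure (μ.map (Ya X N a)) := Measure.isProbabilityMeasure_map hY.aemeasurable
  have hj := joint_law μ X N hX hN hXN hN_law a
  have hm := marg_law μ X N hX hN hXN hN_law a
  set P := μ.map X with hP
  set J := μ.map (fun ω => (X ω, Ya X N a ω)) with hJ
  set Q := P.prod (μ.map (Ya X N a)) with hQ
  set r : (Fin n → ℝ) × (Fin n → ℝ) → ℝ≥0∞ :=
    fun z => ENNReal.ofReal (Lk a z.1 z.2 / pk P a z.2) with hr
  have hpm : Measurable (fun z : (Fin n → ℝ) × (Fin n → ℝ) => pk P a z.2) :=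
    (pk_meas P a).comp measurable_snd
  have hrm : Measurable r := ((Lk_meas a).div hpm).ennreal_ofReal
  have hQe : Q = (P.prod (Gn n)).withDensity (fun z => ENNReal.ofReal (pk P a z.2)) := by
    rw [hQ, hm, prod_withDensity_right (pk_meas P a).ennreal_ofReal]
  have hJe : J = Q.withDensity r := by
    rw [hQe, ← withDensity_mul _ hpm.ennreal_ofReal hrm, hj]
    congr 1
    funext z
    simp only [Pi.mul_apply, hr]
    rw [← ENNReal.ofReal_mul (pk_pos P a _).le]
    congr 1
    have := (pk_pos P a z.2).ne'
    field_simp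
  have hac : J ≪ Q := by rw [hJe]; exact withDensity_absolutelyContinuous _ _
  have hrn : J.rnDeriv Q =ᵐ[J] r := by
    refine hac.ae_le ?_
    rw [hJe]
    exact Measure.rnDeriv_withDensity Q hrm
  have hllr : llr J Q =ᵐ[J] fun z => log (Lk a z.1 z.2) - log (pk P a z.2) := by
    filter_upwards [hrn] with z hz
    rw [llr, hz, hr]
    simp only
    rw [ENNReal.toReal_ofReal (div_pos (Lk_pos _ _ _) (pk_pos _ _ _)).le,
      log_div (Lk_pos _ _ _).ne' (pk_pos _ _ _).ne']
  have hFm : Measurable fun z : (Fin n → ℝ) × (Fin n → ℝ) => log (Lk a z.1 z.2) - log (pk P a z.2) :=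
    (Lk_meas a).log.sub hpm.log
  have hlL : ∀ ω, log (Lk a (X ω) (Ya X N a ω))
      = ∑ j, (a j ^ 2 / 2 * X ω j ^ 2 + a j * (X ω j * N ω j)) := by
    intro ω
    rw [Lk, log_exp]
    refine Finset.sum_congr rfl fun j _ => ?_
    simp only [Ya]; ring
  have hXNi : ∀ j, Integrable (fun ω => X ω j * N ω j) μ := fun j =>
    (X_memLp μ X hX hX2 j).integrable_mul (N_memLp μ N hN hN_law j).1
  have hXN0 : ∀ j, ∫ ω, X ω j * N ω j ∂μ = 0 := fun j => by
    have hc : IndepFun (fun ω => X ω j) (fun ω => N ω j) μ :=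
      hXN.comp (measurable_pi_apply j) (measurable_pi_apply j)
    have := hc.integral_fun_mul_eq_mul_integral (by fun_prop) (by fun_prop)
    rw [this, (N_memLp μ N hN hN_law j).2, mul_zero]
  have hti : ∀ j, Integrable (fun ω => a j ^ 2 / 2 * X ω j ^ 2 + a j * (X ω j * N ω j)) μ :=
    fun j => ((X_sq μ X hX hX2 j).const_mul _).add ((hXNi j).const_mul _)
  have hLi : Integrable (fun ω => log (Lk a (X ω) (Ya X N a ω))) μ := by
    simp_rw [hlL]
    exact integrable_finsetSum _ fun j _ => hti j
  have hlog := log_int μ X N hX hN hN_law hX2 a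
  have hllrInt : Integrable (llr J Q) J := by
    rw [integrable_congr hllr, hJ, integrable_map_measure hFm.aestronglyMeasurable
      (hX.prodMk hY).aemeasurable]
    exact hLi.sub hlog
  have hval : ∫ z, llr J Q z ∂J = ∑ j, a j ^ 2 / 2 * ∫ ω, X ω j ^ 2 ∂μ
      - ∫ y, pk P a y * log (pk P a y) ∂(Gn n) := by
    rw [integral_congr_ae hllr, hJ, integral_map (hX.prodMk hY).aemeasurable
      hFm.aestronglyMeasurable, integral_sub hLi hlog,
      (ent_int μ X N hX hN hXN hN_law hX2 a).2]
    congr 1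
    simp_rw [hlL]
    rw [integral_finsetSum _ fun j _ => hti j]
    refine Finset.sum_congr rfl fun j _ => ?_
    rw [integral_add ((X_sq μ X hX hX2 j).const_mul _) ((hXNi j).const_mul _),
      integral_const_mul, integral_const_mul, hXN0, mul_zero, add_zero]
  unfold mutualInfo klDiv
  rw [if_pos ⟨hac, hllrInt⟩, hval]

end channel

/-- **Sandwich bounds for the discrete-time Gaussian channel** (Theorem 9): the mutual
information is bounded between half SNR times the total filtering MMSE and half SNR times the
total one-step prediction MMSE:
`(snr/2) Σ cmmse(i, snr) ≤ I(Xⁿ; Yⁿ) ≤ (snr/2) Σ pmmse(i, snr)`. -/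
theorem mutualInfo_between_filtering_and_prediction
    {Ω : Type*} [MeasurableSpace Ω] (μ : Measure Ω) [IsProbabilityMeasure μ]
    {n : ℕ} (X N : Ω → Fin n → ℝ)
    (hX : Measurable X) (hN : Measurable N)
    (hXN : IndepFun X N μ)
    (hN_law : μ.map N = Measure.pi fun _ : Fin n => gaussianReal 0 1)
    (hX2 : Integrable (fun ω => ∑ i, X ω i ^ 2) μ) :
    ∀ snr : ℝ, 0 ≤ snr →
      (snr / 2) * ∑ i : Fin n, ∫ ω, (X ω i -
          (μ[fun ω' => X ω' i | obsSigma (chOutN X N snr) (i.1 + 1) i.isLt]) ω) ^ 2 ∂μ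
        ≤ (mutualInfo μ X (chOutN X N snr)).toReal ∧
      (mutualInfo μ X (chOutN X N snr)).toReal
        ≤ (snr / 2) * ∑ i : Fin n, ∫ ω, (X ω i -
            (μ[fun ω' => X ω' i | obsSigma (chOutN X N snr) i.1 i.isLt.le]) ω) ^ 2 ∂μ := by
  intro snr hsnr
  have hPr : IsProbabilityMeasure (μ.map X) := Measure.isProbabilityMeasure_map hX.aemeasurable
  set P := μ.map X with hP
  set s := Real.sqrt snr with hs
  have hs2 : s ^ 2 = snr := Real.sq_sqrt hsnr
  set A : ℕ → Fin n → ℝ := fun m j => if j.1 < m then s else 0 with hA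
  set Ent : ℕ → ℝ := fun m => ∫ y, pk P (A m) y * log (pk P (A m) y) ∂(Gn n) with hEnt
  have hYm : Measurable (chOutN X N snr) := by unfold chOutN; fun_prop
  have hYn : chOutN X N snr = Ya X N (A n) := by
    funext ω j
    simp [chOutN, Ya, hA, hs]
  have hAup : ∀ i : Fin n, A (i.1 + 1) = Function.update (A i.1) i s := by
    intro i
    funext j
    by_cases hj : j = i
    · subst hj; simp [hA]
    · have : j.1 ≠ i.1 := fun h => hj (Fin.ext h)
      simp only [hA, Function.update_of_ne hj]
      have : j.1 < i.1 + 1 ↔ j.1 < i.1 := by omega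
      simp [this]
  have hmm := fun (i : Fin n) (m : ℕ) (hm : m ≤ n) =>
    mmse_eq μ X N hX hN hXN hN_law hX2 (A m) i (chOutN X N snr) hYm m hm
      (fun j hj => by simp [hA, not_lt.2 hj])
      (fun ω j hj => by simp [chOutN, Ya, hA, hj, hs])
  have hstep := fun i : Fin n => step_int P (A i.1) i s (by simp [hA])
    (fun j => (P_int μ X hX hX2 j).1)
    (ent_int μ X N hX hN hXN hN_law hX2 _).1
    (ent_int μ X N hX hN hXN hN_law hX2 _).1 (hmm i i.1 i.isLt.le).1
    (by have := (hmm i (i.1 + 1) i.isLt).1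
        rwa [hAup] at this)
  simp_rw [← hAup] at hstep
  have hE0 : Ent 0 = 0 := by
    have : ∀ y, pk P (A 0) y = 1 := fun y => by simp [pk, Lk, hA]
    simp [hEnt, this]
  have htel : ∑ i : Fin n, (Ent (i.1 + 1) - Ent i.1) = Ent n := by
    rw [Fin.sum_univ_eq_sum_range (fun i => Ent (i + 1) - Ent i) n, Finset.sum_range_sub, hE0,
      sub_zero]
  have hMI : mutualInfo μ X (chOutN X N snr) = ENNReal.ofReal
      (∑ i : Fin n, (snr / 2 * ∫ ω, X ω i ^ 2 ∂μ - (Ent (i.1 + 1) - Ent i.1))) := by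
    rw [hYn, mutualInfo_eq μ X N hX hN hXN hN_law hX2, Finset.sum_sub_distrib, htel]
    congr 2
    refine Finset.sum_congr rfl fun j _ => ?_
    simp [hA, hs2]
  have hle : ∀ x : ℝ, x ≤ (ENNReal.ofReal x).toReal := fun x => by
    rw [ENNReal.toReal_ofReal']; exact le_max_left _ _
  rw [hMI]
  constructor
  · refine le_trans ?_ (hle _)
    rw [Finset.mul_sum]
    refine Finset.sum_le_sum fun i _ => ?_
    rw [(hmm i (i.1 + 1) i.isLt).2]
    have := (hstep i).2
    rw [hs2] at this
    rw [mul_sub]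
    exact sub_le_sub_left this _
  · rw [ENNReal.toReal_ofReal']
    refine max_le ?_ ?_
    · rw [Finset.mul_sum]
      refine Finset.sum_le_sum fun i _ => ?_
      rw [(hmm i i.1 i.isLt.le).2]
      have := (hstep i).1
      rw [hs2] at this
      rw [mul_sub]
      exact sub_le_sub_left this _
    · refine mul_nonneg (by linarith) (Finset.sum_nonneg fun i _ => integral_nonneg fun ω => ?_)
      exact sq_nonneg _
end
end

section
/- For every discrete real-valued random variable X (taking at most countably many values), the entropy of X in nats equals the limit of the input–output mutual information of the Gaussian channel as the SNR grows without bound: H(X) = lim_{snr→∞} I(X; √snr · X + N), where both sides may equal +∞. -/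
open MeasureTheory ProbabilityTheory Real Filter
open scoped ENNReal NNReal Topology

noncomputable section

/-- Output `Y = √snr · X + N` of the scalar Gaussian channel at signal-to-noise ratio `snr`. -/
def chOut {Ω : Type*} (X N : Ω → ℝ) (snr : ℝ) : Ω → ℝ := fun ω => Real.sqrt snr * X ω + N ω

/-- Minimum mean-square error `E[(X - E[X | Y])²]` of estimating `X` given `Y`. -/
def mmse {Ω : Type*} [MeasurableSpace Ω] (μ : Measure Ω) (X Y : Ω → ℝ) : ℝ :=
  ∫ ω, (X ω - (μ[X | MeasurableSpace.comap Y inferInstance]) ω) ^ 2 ∂μ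


namespace EntropyLimit

/-- standard Gaussian density -/
def gd (t : ℝ) : ℝ≥0∞ := gaussianPDF 0 1 t

lemma gd_meas : Measurable gd := measurable_gaussianPDF 0 1

lemma gd_pos (t : ℝ) : 0 < gd t := gaussianPDF_pos 0 one_ne_zero t

lemma gd_ne_top (t : ℝ) : gd t ≠ ∞ := gaussianPDF_ne_top

lemma gd_eq (t : ℝ) : gd t = ENNReal.ofReal ((√(2 * π))⁻¹ * rexp (-t ^ 2 / 2)) := by
  simp [gd, gaussianPDF, gaussianPDFReal]

lemma gd_le (t : ℝ) : gd t ≤ gd 0 := by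
  rw [gd_eq, gd_eq]
  apply ENNReal.ofReal_le_ofReal
  apply mul_le_mul_of_nonneg_left _ (by positivity)
  apply Real.exp_le_exp.2
  nlinarith [sq_nonneg t]

lemma gd_lint : ∫⁻ t, gd t = 1 := lintegral_gaussianPDF_eq_one 0 one_ne_zero

lemma gd_tendsto (c n : ℝ) (hc : c ≠ 0) :
    Tendsto (fun snr : ℝ => gd (√snr * c + n)) atTop (𝓝 0) := by
  have h0 : Tendsto (fun t : ℝ => ENNReal.ofReal ((√(2 * π))⁻¹ * rexp (-t / 2))) atTop (𝓝 0) := by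
    rw [← ENNReal.ofReal_zero]
    apply ENNReal.tendsto_ofReal
    rw [← mul_zero ((√(2 * π))⁻¹)]
    apply Tendsto.const_mul
    apply Real.tendsto_exp_atBot.comp
    exact (tendsto_neg_atTop_atBot).atBot_div_const (by norm_num)
  have h1 : Tendsto (fun snr : ℝ => (√snr * c + n) ^ 2) atTop atTop := by
    have h2 : Tendsto (fun snr : ℝ => |√snr * c + n|) atTop atTop := by
      rcases lt_or_gt_of_ne hc with h | h
      · exact tendsto_abs_atBot_atTop.comp
          (tendsto_atBot_add_const_right _ _ (tendsto_sqrt_atTop.atTop_mul_const_of_neg h))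
      · exact tendsto_abs_atTop_atTop.comp
          (tendsto_atTop_add_const_right _ _ (tendsto_sqrt_atTop.atTop_mul_const h))
    have h3 := (tendsto_pow_atTop (α := ℝ) two_ne_zero).comp h2
    simpa [Function.comp_def, sq_abs] using h3
  simpa only [gd_eq, Function.comp_def] using h0.comp h1

/-- output density -/
def qd (P : Measure ℝ) (s y : ℝ) : ℝ≥0∞ := ∫⁻ x, gd (y - s * x) ∂P

/-- density ratio -/
def rd (P : Measure ℝ) (s : ℝ) (z : ℝ × ℝ) : ℝ≥0∞ := gd (z.2 - s * z.1) / qd P s z.2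

variable (P : Measure ℝ) [IsProbabilityMeasure P]

lemma gd_meas2 (s : ℝ) : Measurable (fun z : ℝ × ℝ => gd (z.2 - s * z.1)) :=
  gd_meas.comp (by fun_prop)

lemma qd_meas (s : ℝ) : Measurable (qd P s) := by
  unfold qd
  exact Measurable.lintegral_prod_left' (f := fun z : ℝ × ℝ => gd (z.2 - s * z.1)) (gd_meas2 s)

lemma rd_meas (s : ℝ) : Measurable (rd P s) :=
  (gd_meas2 s).div ((qd_meas P s).comp measurable_snd)

lemma qd_le (s y : ℝ) : qd P s y ≤ gd 0 := by
  unfold qd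
  calc _ ≤ ∫⁻ x, gd 0 ∂P := lintegral_mono fun x => gd_le _
    _ = _ := by simp

lemma qd_ne_top (s y : ℝ) : qd P s y ≠ ∞ := ne_top_of_le_ne_top (gd_ne_top 0) (qd_le P s y)

lemma qd_ne_zero (s y : ℝ) : qd P s y ≠ 0 := by
  intro h
  unfold qd at h
  have hm : Measurable fun x => gd (y - s * x) := gd_meas.comp (by fun_prop)
  rw [lintegral_eq_zero_iff hm] at h
  obtain ⟨x, hx⟩ := h.exists
  exact (gd_pos _).ne' hx

lemma qd_ge (s x y : ℝ) : gd (y - s * x) * P {x} ≤ qd P s y := by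
  unfold qd
  calc _ = ∫⁻ x' in {x}, gd (y - s * x') ∂P := by
          rw [lintegral_singleton]
    _ ≤ _ := setLIntegral_le_lintegral _ _

lemma rd_ne_top (s : ℝ) (z : ℝ × ℝ) : rd P s z ≠ ∞ :=
  ENNReal.div_ne_top (gd_ne_top _) (qd_ne_zero P s _)

lemma rd_mul_le (s x y : ℝ) : rd P s (x, y) * P {x} ≤ 1 := by
  unfold rd
  rw [div_eq_mul_inv, mul_right_comm, ← div_eq_mul_inv]
  exact ENNReal.div_le_of_le_mul (by simpa using qd_ge P s x y)

section channel
variable {Ω : Type*} [MeasurableSpace Ω] (μ : Measure Ω) [IsProbabilityMeasure μ]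
    (X N : Ω → ℝ)

lemma lint_joint (hX : Measurable X) (hN : Measurable N)
    (hXN : IndepFun X N μ)
    (hN_law : μ.map N = gaussianReal 0 1)
    (s : ℝ) (F : ℝ × ℝ → ℝ≥0∞) (hF : Measurable F) :
    ∫⁻ ω, F (X ω, s * X ω + N ω) ∂μ = ∫⁻ x, ∫⁻ y, gd (y - s * x) * F (x, y) ∂volume ∂(μ.map X) := by
  have h := hXN.map_prod_eq_prod_map_map hX.aemeasurable hN.aemeasurable
  have hT : Measurable (fun z : ℝ × ℝ => (z.1, s * z.1 + z.2)) := by fun_prop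
  have hFT : Measurable (fun z : ℝ × ℝ => F (z.1, s * z.1 + z.2)) := hF.comp hT
  have : IsProbabilityMeasure (μ.map X) := Measure.isProbabilityMeasure_map hX.aemeasurable
  calc _ = ∫⁻ z, F (z.1, s * z.1 + z.2) ∂(μ.map fun ω => (X ω, N ω)) := by
        rw [lintegral_map hFT (hX.prodMk hN)]
    _ = ∫⁻ x, ∫⁻ n, F (x, s * x + n) ∂(gaussianReal 0 1) ∂(μ.map X) := by
        rw [h, hN_law, lintegral_prod _ hFT.aemeasurable]
    _ = _ := by
        refine lintegral_congr fun x => ?_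
        rw [gaussianReal_of_var_ne_zero 0 one_ne_zero,
          lintegral_withDensity_eq_lintegral_mul _ (measurable_gaussianPDF 0 1) (by fun_prop),
          ← lintegral_add_left_eq_self (fun y => gd (y - s * x) * F (x, y)) (s * x)]
        simp [gd]

lemma lint_out (hX : Measurable X) (hN : Measurable N)
    (hXN : IndepFun X N μ)
    (hN_law : μ.map N = gaussianReal 0 1)
    (s : ℝ) (F : ℝ → ℝ≥0∞) (hF : Measurable F) :
    ∫⁻ ω, F (s * X ω + N ω) ∂μ = ∫⁻ y, qd (μ.map X) s y * F y := by
  have : IsProbabilityMeasure (μ.map X) := Measure.isProbabilityMeasure_map hX.aemeasurable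
  rw [lint_joint μ X N hX hN hXN hN_law s (fun z => F z.2) (hF.comp measurable_snd),
    lintegral_lintegral_swap]
  · refine lintegral_congr fun y => ?_
    have hm : Measurable fun x => gd (y - s * x) := gd_meas.comp (by fun_prop)
    simp only
    rw [lintegral_mul_const _ hm]
    rfl
  · exact ((gd_meas2 s).mul (hF.comp measurable_snd)).aemeasurable

lemma joint_eq (hX : Measurable X) (hN : Measurable N)
    (hXN : IndepFun X N μ)
    (hN_law : μ.map N = gaussianReal 0 1)
    (s : ℝ) : (μ.map fun ω => (X ω, s * X ω + N ω)) =
    ((μ.map X).prod (μ.map fun ω => s * X ω + N ω)).withDensity (rd (μ.map X) s) := by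
  have : IsProbabilityMeasure (μ.map X) := Measure.isProbabilityMeasure_map hX.aemeasurable
  have hY : Measurable fun ω => s * X ω + N ω := by fun_prop
  have : IsProbabilityMeasure (μ.map fun ω => s * X ω + N ω) :=
    Measure.isProbabilityMeasure_map hY.aemeasurable
  refine Measure.ext_of_lintegral _ fun F hF => ?_
  have hr := rd_meas (μ.map X) s
  rw [lintegral_map hF (hX.prodMk hY), lint_joint μ X N hX hN hXN hN_law s F hF,
    lintegral_withDensity_eq_lintegral_mul _ hr hF, lintegral_prod _ (hr.mul hF).aemeasurable]
  refine lintegral_congr fun x => ?_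
  have hm : Measurable fun y => (rd (μ.map X) s * F) (x, y) := (hr.mul hF).comp (by fun_prop)
  rw [lintegral_map hm hY,
    lint_out μ X N hX hN hXN hN_law s (fun y => (rd (μ.map X) s * F) (x, y))
      hm]
  refine lintegral_congr fun y => ?_
  simp only [Pi.mul_apply, rd]
  rw [← mul_assoc, ENNReal.mul_div_cancel (qd_ne_zero _ _ _) (qd_ne_top _ _ _)]

lemma lint_rd (hX : Measurable X) (hN : Measurable N)
    (hXN : IndepFun X N μ)
    (hN_law : μ.map N = gaussianReal 0 1)
    (s x : ℝ) : ∫⁻ ω, rd (μ.map X) s (x, s * X ω + N ω) ∂μ = 1 := by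
  have : IsProbabilityMeasure (μ.map X) := Measure.isProbabilityMeasure_map hX.aemeasurable
  rw [lint_out μ X N hX hN hXN hN_law s (fun y => rd (μ.map X) s (x, y))
    ((rd_meas _ s).comp (by fun_prop))]
  simp only [rd]
  simp_rw [ENNReal.mul_div_cancel (qd_ne_zero (μ.map X) s _) (qd_ne_top (μ.map X) s _)]
  rw [lintegral_sub_right_eq_self (fun y => gd y), gd_lint]

lemma mi_eq (hX : Measurable X) (hN : Measurable N)
    (hXN : IndepFun X N μ)
    (hN_law : μ.map N = gaussianReal 0 1)
    (snr : ℝ) : mutualInfo μ X (chOut X N snr) =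
    ∫⁻ x, ∫⁻ ω, ENNReal.ofReal (InformationTheory.klFun
      (rd (μ.map X) (√snr) (x, √snr * X ω + N ω)).toReal) ∂μ ∂(μ.map X) := by
  have : IsProbabilityMeasure (μ.map X) := Measure.isProbabilityMeasure_map hX.aemeasurable
  have hY : Measurable fun ω => √snr * X ω + N ω := by fun_prop
  have i1 : IsProbabilityMeasure (μ.map fun ω => √snr * X ω + N ω) :=
    Measure.isProbabilityMeasure_map hY.aemeasurable
  have i2 : IsProbabilityMeasure (μ.map fun ω => (X ω, √snr * X ω + N ω)) :=
    Measure.isProbabilityMeasure_map (hX.prodMk hY).aemeasurable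
  have hr := rd_meas (μ.map X) (√snr)
  have hk : Measurable fun z => ENNReal.ofReal (InformationTheory.klFun
      (rd (μ.map X) (√snr) z).toReal) :=
    (InformationTheory.measurable_klFun.comp hr.ennreal_toReal).ennreal_ofReal
  have hj := joint_eq μ X N hX hN hXN hN_law (√snr)
  have h1 : mutualInfo μ X (chOut X N snr) = InformationTheory.klDiv
      (μ.map fun ω => (X ω, √snr * X ω + N ω))
      ((μ.map X).prod (μ.map fun ω => √snr * X ω + N ω)) := by
    rw [InformationTheory.klDiv_def, mutualInfo, klDiv]
    simp only [chOut, probReal_univ, add_sub_cancel_right]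
    rfl
  rw [h1, InformationTheory.klDiv_eq_lintegral_klFun_of_ac
    (hj ▸ withDensity_absolutelyContinuous _ _)]
  have hrn := Measure.rnDeriv_withDensity
    ((μ.map X).prod (μ.map fun ω => √snr * X ω + N ω)) hr
  rw [← hj] at hrn
  rw [lintegral_congr_ae (g := fun z => ENNReal.ofReal (InformationTheory.klFun
      (rd (μ.map X) (√snr) z).toReal)) (hrn.mono fun z hz => by simp only [hz]),
    lintegral_prod _ hk.aemeasurable]
  refine lintegral_congr fun x => ?_
  have hm : Measurable fun y => ENNReal.ofReal (InformationTheory.klFun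
      (rd (μ.map X) (√snr) (x, y)).toReal) := hk.comp (by fun_prop)
  rw [lintegral_map hm hY]

lemma upper (hX : Measurable X) (hN : Measurable N)
    (hXN : IndepFun X N μ)
    (hN_law : μ.map N = gaussianReal 0 1)
    (s x : ℝ) (hx : (μ.map X) {x} ≠ 0) :
    ∫⁻ ω, ENNReal.ofReal (InformationTheory.klFun
      (rd (μ.map X) s (x, s * X ω + N ω)).toReal) ∂μ
      ≤ ENNReal.ofReal (-Real.log ((μ.map X) {x}).toReal) := by
  have : IsProbabilityMeasure (μ.map X) := Measure.isProbabilityMeasure_map hX.aemeasurable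
  have hr : Measurable fun ω => rd (μ.map X) s (x, s * X ω + N ω) :=
    (rd_meas (μ.map X) s).comp (by fun_prop)
  have h1 := lint_rd μ X N hX hN hXN hN_law s x
  set p := ((μ.map X) {x}).toReal with hp
  have hp0 : 0 < p := ENNReal.toReal_pos hx (measure_ne_top _ _)
  have hp1 : p ≤ 1 := measureReal_le_one
  have hlog : 0 ≤ -Real.log p := by linarith [Real.log_nonpos hp0.le hp1]
  refine (ENNReal.add_le_add_iff_right (ENNReal.one_ne_top)).1 ?_
  calc _ = ∫⁻ ω, ENNReal.ofReal (InformationTheory.klFun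
      (rd (μ.map X) s (x, s * X ω + N ω)).toReal) + rd (μ.map X) s (x, s * X ω + N ω) ∂μ := by
        rw [lintegral_add_right _ hr, h1]
    _ ≤ ∫⁻ ω, ENNReal.ofReal (-Real.log p) * rd (μ.map X) s (x, s * X ω + N ω) + 1 ∂μ := by
        refine lintegral_mono fun ω => ?_
        set r := rd (μ.map X) s (x, s * X ω + N ω) with hrd
        have hrt : r ≠ ∞ := rd_ne_top _ _ _
        have hle : r.toReal * p ≤ 1 := by
          rw [hp, ← ENNReal.toReal_mul]
          exact ENNReal.toReal_mono ENNReal.one_ne_top (rd_mul_le (μ.map X) s x _)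
        have hr0 : 0 ≤ r.toReal := ENNReal.toReal_nonneg
        nth_rewrite 2 3 [← ENNReal.ofReal_toReal hrt]
        rw [← ENNReal.ofReal_mul hlog, ← ENNReal.ofReal_one,
          ← ENNReal.ofReal_add (InformationTheory.klFun_nonneg hr0) hr0,
          ← ENNReal.ofReal_add (by positivity) zero_le_one]
        apply ENNReal.ofReal_le_ofReal
        rw [InformationTheory.klFun_apply]
        rcases hr0.eq_or_lt with h | h
        · simp [← h]
        · have : Real.log r.toReal + Real.log p ≤ 0 := by
            rw [← Real.log_mul h.ne' hp0.ne']
            exact Real.log_nonpos (by positivity) hle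
          nlinarith
    _ = _ := by
        rw [lintegral_add_right _ measurable_const, lintegral_const_mul _ hr, h1]
        simp

lemma rd_tendsto (x a n : ℝ) (ha : P {a} ≠ 0) :
    Tendsto (fun snr : ℝ => rd P (√snr) (x, √snr * a + n)) atTop
      (𝓝 (if x = a then (P {a})⁻¹ else 0)) := by
  have hg : ∀ x, Tendsto (fun snr : ℝ => gd (√snr * a + n - √snr * x)) atTop
      (𝓝 (if x = a then gd n else 0)) := by
    intro x
    split_ifs with h
    · simp [h]
    · convert gd_tendsto (a - x) n (sub_ne_zero.2 (Ne.symm h)) using 3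
      ring
  have hq : Tendsto (fun snr : ℝ => qd P (√snr) (√snr * a + n)) atTop (𝓝 (gd n * P {a})) := by
    have := tendsto_lintegral_filter_of_dominated_convergence (μ := P)
      (F := fun snr x => gd (√snr * a + n - √snr * x)) (l := atTop) (fun _ => gd 0)
      (.of_forall fun s => gd_meas.comp (by fun_prop))
      (.of_forall fun s => .of_forall fun x => gd_le _)
      (by simpa using gd_ne_top 0) (.of_forall fun x => hg x)
    have e : gd n * P {a} = ∫⁻ x, (if x = a then gd n else 0) ∂P := by
     calc gd n * P {a} = ∫⁻ x, Set.indicator {a} (fun _ => gd n) x ∂P := by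
            rw [lintegral_indicator (measurableSet_singleton a)]; simp
      _ = _ := by
            refine lintegral_congr fun x => ?_
            simp [Set.indicator_apply]
    rw [e]
    exact this
  have h0 : gd n * P {a} ≠ 0 := mul_ne_zero (gd_pos n).ne' ha
  have := ENNReal.Tendsto.div (hg x) (Or.inr h0) hq (Or.inr ?_)
  · simp only [rd]
    convert this using 2
    split_ifs
    · rw [ENNReal.div_eq_inv_mul, ENNReal.mul_inv (Or.inl (gd_pos n).ne') (Or.inl (gd_ne_top n)),
        mul_right_comm, ENNReal.inv_mul_cancel (gd_pos n).ne' (gd_ne_top n), one_mul]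
    · simp
  · split_ifs
    · exact gd_ne_top n
    · simp

lemma lint_lim (a : ℝ) (ha : P {a} ≠ 0) :
    ∫⁻ x, ENNReal.ofReal (InformationTheory.klFun (if x = a then (P {a})⁻¹ else 0).toReal) ∂P
      = ENNReal.ofReal (-Real.log (P {a}).toReal) := by
  have hp0 : 0 < (P {a}).toReal := ENNReal.toReal_pos ha (measure_ne_top _ _)
  have hp1 : (P {a}).toReal ≤ 1 := measureReal_le_one
  rw [← lintegral_add_compl _ (measurableSet_singleton a), lintegral_singleton,
    setLIntegral_congr_fun (g := fun _ => 1) (measurableSet_singleton a).compl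
      (fun x hx => by
        have : x ≠ a := hx
        simp [this, InformationTheory.klFun_zero])]
  rw [setLIntegral_const, one_mul, prob_compl_eq_one_sub (measurableSet_singleton a)]
  have e : P {a} = ENNReal.ofReal (P {a}).toReal := (ENNReal.ofReal_toReal (measure_ne_top _ _)).symm
  simp only [if_true, ENNReal.toReal_inv]
  set p := (P {a}).toReal
  rw [e, ← ENNReal.ofReal_one, ← ENNReal.ofReal_sub _ hp0.le,
    ← ENNReal.ofReal_mul (InformationTheory.klFun_nonneg (by positivity)),
    ← ENNReal.ofReal_add (mul_nonneg (InformationTheory.klFun_nonneg (by positivity)) hp0.le)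
      (by linarith)]
  congr 1
  rw [InformationTheory.klFun_apply, Real.log_inv]
  field_simp
  ring

end channel

end EntropyLimit

/-- **Entropy as high-SNR limit of mutual information** (Lemma 6): for every discrete
real-valued random variable `X`, `H(X) = lim_{snr→∞} I(X; √snr·X + N)`, where both sides may
equal `+∞`. -/
theorem tendsto_mutualInfo_atTop_entropy
    {Ω : Type*} [MeasurableSpace Ω] (μ : Measure Ω) [IsProbabilityMeasure μ]
    (X N : Ω → ℝ) (hX : Measurable X) (hN : Measurable N)
    (hX_discrete : Set.Countable (Set.range X))
    (hXN : IndepFun X N μ)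
    (hN_law : μ.map N = gaussianReal 0 1) :
    Tendsto (fun snr : ℝ => mutualInfo μ X (chOut X N snr)) atTop
      (𝓝 (∑' x : ℝ, ENNReal.ofReal (Real.negMulLog ((μ.map X) {x}).toReal))) := by
  have iP : IsProbabilityMeasure (μ.map X) := Measure.isProbabilityMeasure_map hX.aemeasurable
  have hp : Measurable fun x => (μ.map X) {x} := by
    have h := measurable_measure_prodMk_left (ν := μ.map X)
      (s := {z : ℝ × ℝ | z.2 = z.1}) (measurableSet_eq_fun measurable_snd measurable_fst)
    exact h
  have hrange : ∀ᵐ x ∂(μ.map X), x ∈ Set.range X := by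
    refine (ae_map_iff hX.aemeasurable (p := fun x => x ∈ Set.range X)
      hX_discrete.measurableSet).2 ?_
    exact .of_forall fun ω => ⟨ω, rfl⟩
  have hpos : ∀ᵐ x ∂(μ.map X), (μ.map X) {x} ≠ 0 := by
    have hnull : (μ.map X) (Set.range X ∩ {x | (μ.map X) {x} = 0}) = 0 := by
      rw [← Set.biUnion_of_singleton (Set.range X ∩ {x | (μ.map X) {x} = 0}),
        measure_biUnion_null_iff (hX_discrete.mono Set.inter_subset_left)]
      exact fun x hx => hx.2
    filter_upwards [hrange, measure_eq_zero_iff_ae_notMem.1 hnull] with x h1 h2 h3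
    exact h2 ⟨h1, h3⟩
  have hposω : ∀ᵐ ω ∂μ, (μ.map X) {X ω} ≠ 0 := ae_of_ae_map hX.aemeasurable hpos
  have hent : ∑' x : ℝ, ENNReal.ofReal (Real.negMulLog ((μ.map X) {x}).toReal) =
      ∫⁻ x, ENNReal.ofReal (-Real.log ((μ.map X) {x}).toReal) ∂(μ.map X) := by
    have e : ∀ x : ℝ, ENNReal.ofReal (-Real.log ((μ.map X) {x}).toReal) * (μ.map X) {x} =
        ENNReal.ofReal (Real.negMulLog ((μ.map X) {x}).toReal) := by
      intro x
      conv_lhs => rw [← ENNReal.ofReal_toReal (measure_ne_top (μ.map X) {x})]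
      rw [ENNReal.toReal_ofReal ENNReal.toReal_nonneg,
        ← ENNReal.ofReal_mul' ENNReal.toReal_nonneg, Real.negMulLog]
      congr 1
      ring
    rw [← Measure.restrict_eq_self_of_ae_mem hrange, lintegral_countable _ hX_discrete,
      Measure.restrict_eq_self_of_ae_mem hrange]
    simp_rw [e]
    symm
    apply tsum_subtype_eq_of_support_subset
      (f := fun x => ENNReal.ofReal (Real.negMulLog ((μ.map X) {x}).toReal))
    intro x hx
    by_contra hxr
    apply hx
    have : (μ.map X) {x} = 0 :=
      measure_mono_null (fun y hy => by rw [Set.mem_singleton_iff.1 hy]; exact hxr) hrange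
    simp [this]
  rw [hent]
  have hkm : ∀ snr : ℝ, Measurable fun z : ℝ × Ω => ENNReal.ofReal (InformationTheory.klFun
      (EntropyLimit.rd (μ.map X) (√snr) (z.1, √snr * X z.2 + N z.2)).toReal) := fun snr =>
    (InformationTheory.measurable_klFun.comp
      ((EntropyLimit.rd_meas (μ.map X) (√snr)).comp (by fun_prop)).ennreal_toReal).ennreal_ofReal
  simp_rw [EntropyLimit.mi_eq μ X N hX hN hXN hN_law]
  refine tendsto_of_le_liminf_of_limsup_le ?_ ?_
  · -- Fatou on the product space
    simp_rw [← fun snr => lintegral_prod (μ := μ.map X) (ν := μ) _ (hkm snr).aemeasurable]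
    refine le_trans (le_of_eq ?_) (lintegral_liminf_le hkm)
    have hlim : ∀ᵐ z ∂((μ.map X).prod μ), liminf (fun snr : ℝ =>
        ENNReal.ofReal (InformationTheory.klFun
          (EntropyLimit.rd (μ.map X) (√snr) (z.1, √snr * X z.2 + N z.2)).toReal)) atTop =
        ENNReal.ofReal (InformationTheory.klFun
          (if z.1 = X z.2 then ((μ.map X) {X z.2})⁻¹ else 0).toReal) := by
      filter_upwards [Measure.quasiMeasurePreserving_snd.ae hposω] with z hz
      apply Tendsto.liminf_eq
      apply ENNReal.tendsto_ofReal
      apply (InformationTheory.continuous_klFun.tendsto _).comp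
      refine (ENNReal.tendsto_toReal ?_).comp
        (EntropyLimit.rd_tendsto (μ.map X) z.1 (X z.2) (N z.2) hz)
      split_ifs
      · exact ENNReal.inv_ne_top.2 hz
      · simp
    have hmeas : AEMeasurable (fun z : ℝ × Ω => ENNReal.ofReal (InformationTheory.klFun
          (if z.1 = X z.2 then ((μ.map X) {X z.2})⁻¹ else 0).toReal)) ((μ.map X).prod μ) := by
      refine Measurable.aemeasurable ?_
      refine (InformationTheory.measurable_klFun.comp
        (Measurable.ennreal_toReal ?_)).ennreal_ofReal
      exact Measurable.ite (measurableSet_eq_fun measurable_fst (hX.comp measurable_snd))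
        ((hp.comp (hX.comp measurable_snd)).inv) measurable_const
    rw [lintegral_congr_ae hlim, lintegral_prod_symm _ hmeas]
    have hpm : Measurable fun x => ENNReal.ofReal (-Real.log ((μ.map X) {x}).toReal) := 
      (Real.measurable_log.comp hp.ennreal_toReal).neg.ennreal_ofReal
    rw [lintegral_map hpm hX]
    refine lintegral_congr_ae ?_
    filter_upwards [hposω] with ω hω
    exact (EntropyLimit.lint_lim (μ.map X) (X ω) hω).symm
  · refine limsup_le_of_le (h := .of_forall fun snr => ?_)
    refine lintegral_mono_ae ?_
    filter_upwards [hpos] with x hx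
    exact EntropyLimit.upper μ X N hX hN hXN hN_law _ x hx
end
end

section
/- Let X be a real-valued random variable with finite variance and let X' ~ N(E[X], Var(X)) be Gaussian with the same mean and variance. With Y = √snr · X + N and Y' = √snr · X' + N, the divergence between the input laws is the limit of the divergence between the output laws: D(P_X ‖ P_{X'}) = lim_{snr→∞} D(P_Y ‖ P_{Y'}), where both sides may equal +∞. -/
open MeasureTheory ProbabilityTheory Real Filter
open scoped ENNReal NNReal Topology

noncomputable section

lemma klDiv_eq_mathlib {α : Type*} [MeasurableSpace α] (P Q : Measure α)
    [IsProbabilityMeasure P] [IsProbabilityMeasure Q] :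
    klDiv P Q = InformationTheory.klDiv P Q := by
  rw [InformationTheory.klDiv_def]
  simp [klDiv]

lemma young_klFun {r : ℝ} (hr : 0 ≤ r) (g : ℝ) :
    r * g - (Real.exp g - 1) ≤ InformationTheory.klFun r := by
  rw [InformationTheory.klFun_apply]
  rcases hr.eq_or_lt with rfl | h
  · have := Real.exp_pos g
    simp; linarith
  · have h1 := Real.add_one_le_exp (g - Real.log r)
    rw [Real.exp_sub, Real.exp_log h, le_div_iff₀ h] at h1
    nlinarith

lemma bdd_integrable {α : Type*} [MeasurableSpace α] (P : Measure α) [IsFiniteMeasure P]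
    (g : α → ℝ) (hg : Measurable g) (K : ℝ) (hK : ∀ x, |g x| ≤ K) : Integrable g P :=
  Integrable.of_bound hg.aestronglyMeasurable K (ae_of_all _ hK)

lemma bdd_exp_integrable {α : Type*} [MeasurableSpace α] (P : Measure α) [IsFiniteMeasure P]
    (g : α → ℝ) (hg : Measurable g) (K : ℝ) (hK : ∀ x, |g x| ≤ K) :
    Integrable (fun x => Real.exp (g x) - 1) P := by
  refine Integrable.sub ?_ (integrable_const _)
  refine bdd_integrable P _ hg.exp (Real.exp K) fun x => ?_
  rw [abs_of_pos (Real.exp_pos _)]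
  exact Real.exp_le_exp.2 ((le_abs_self _).trans (hK x))

lemma variational_eq {α : Type*} [MeasurableSpace α] (P Q : Measure α)
    [IsProbabilityMeasure P] [IsProbabilityMeasure Q] (hPQ : P ≪ Q)
    (g : α → ℝ) (hg : Measurable g) (K : ℝ) (hK : ∀ x, |g x| ≤ K) :
    Integrable (fun x => (P.rnDeriv Q x).toReal * g x - (Real.exp (g x) - 1)) Q ∧
    ∫ x, g x ∂P - ∫ x, (Real.exp (g x) - 1) ∂Q =
      ∫ x, ((P.rnDeriv Q x).toReal * g x - (Real.exp (g x) - 1)) ∂Q := by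
  have h1 : Integrable (fun x => (P.rnDeriv Q x).toReal * g x) Q := by
    have := (integrable_rnDeriv_smul_iff (f := g) hPQ).2 (bdd_integrable P g hg K hK)
    simpa [smul_eq_mul] using this
  have h2 := bdd_exp_integrable Q g hg K hK
  refine ⟨h1.sub h2, ?_⟩
  rw [integral_sub h1 h2]
  congr 1
  have := integral_rnDeriv_smul (f := g) hPQ
  simpa [smul_eq_mul] using this.symm

lemma variational_le {α : Type*} [MeasurableSpace α] (P Q : Measure α)
    [IsProbabilityMeasure P] [IsProbabilityMeasure Q]
    (g : α → ℝ) (hg : Measurable g) (K : ℝ) (hK : ∀ x, |g x| ≤ K) :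
    ENNReal.ofReal (∫ x, g x ∂P - ∫ x, (Real.exp (g x) - 1) ∂Q) ≤ klDiv P Q := by
  rw [klDiv_eq_mathlib, InformationTheory.klDiv_eq_integral_klFun]
  split_ifs with h
  · obtain ⟨hi, he⟩ := variational_eq P Q h.1 g hg K hK
    rw [he]
    refine ENNReal.ofReal_le_ofReal (integral_mono hi ?_ fun x => ?_)
    · exact (InformationTheory.integrable_klFun_rnDeriv_iff h.1).2 h.2
    · exact young_klFun ENNReal.toReal_nonneg _
  · exact le_top

lemma exists_measurable {α : Type*} [MeasurableSpace α] (P Q : Measure α)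
    [IsProbabilityMeasure P] [IsProbabilityMeasure Q] (c : ℝ≥0∞) (hc : c < klDiv P Q) :
    ∃ (g : α → ℝ) (K : ℝ), Measurable g ∧ (∀ x, |g x| ≤ K) ∧
      c < ENNReal.ofReal (∫ x, g x ∂P - ∫ x, (Real.exp (g x) - 1) ∂Q) := by
  by_cases hPQ : P ≪ Q
  · rw [klDiv_eq_mathlib, InformationTheory.klDiv_eq_lintegral_klFun_of_ac hPQ] at hc
    set r : α → ℝ := fun x => (P.rnDeriv Q x).toReal with hr
    have hrm : Measurable r := (Measure.measurable_rnDeriv P Q).ennreal_toReal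
    have hr0 : ∀ x, 0 ≤ r x := fun x => ENNReal.toReal_nonneg
    let t : ℕ → α → ℝ := fun k x => max (1 / ((k : ℝ) + 1)) (min (r x) ((k : ℝ) + 1))
    have htm : ∀ k, Measurable (t k) := fun k => by fun_prop
    have hk0 : ∀ k : ℕ, 0 < 1 / ((k : ℝ) + 1) := fun k => by positivity
    have ht_pos : ∀ k x, 0 < t k x := fun k x => lt_max_of_lt_left (hk0 k)
    have hk1 : ∀ k : ℕ, 1 / ((k : ℝ) + 1) ≤ 1 := fun k => by
      rw [div_le_one (by positivity)]; linarith [(Nat.cast_nonneg k : (0:ℝ) ≤ k)]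
    have ht_le : ∀ k x, t k x ≤ (k : ℝ) + 1 := fun k x =>
      max_le ((hk1 k).trans (by linarith [(Nat.cast_nonneg k : (0:ℝ) ≤ k)])) (min_le_right _ _)
    have hb : ∀ k x, |Real.log (t k x)| ≤ Real.log ((k : ℝ) + 1) := fun k x => by
      rw [abs_le]
      constructor
      · rw [← Real.log_inv, ← one_div]
        exact Real.log_le_log (hk0 k) (le_max_left _ _)
      · exact Real.log_le_log (ht_pos k x) (ht_le k x)
    have hF0 : ∀ k x, 0 ≤ r x * Real.log (t k x) - (t k x - 1) := fun k x => by
      have h1 := InformationTheory.klFun_nonneg (ht_pos k x).le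
      rw [InformationTheory.klFun_apply] at h1
      have h2 : 0 ≤ (r x - t k x) * Real.log (t k x) := by
        rcases le_total (t k x) (r x) with h | h
        · rcases h.eq_or_lt with h | h
          · simp [h]
          · have : 1 ≤ t k x ∨ t k x = r x := by
              by_cases h3 : r x ≤ (k : ℝ) + 1
              · exfalso
                have : r x ≤ t k x := by
                  simp only [t, min_eq_left h3]; exact le_max_right _ _
                linarith
              · left
                have : (k : ℝ) + 1 ≤ t k x := by
                  simp only [t, min_eq_right (not_le.1 h3).le]; exact le_max_right _ _
                linarith [(Nat.cast_nonneg k : (0:ℝ) ≤ k)]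
            rcases this with h3 | h3
            · exact mul_nonneg (by linarith) (Real.log_nonneg h3)
            · simp [h3]
        · rcases h.eq_or_lt with h | h
          · simp [h]
          · have h3 : t k x ≤ 1 := by
              by_contra h4
              have h5 : t k x = min (r x) ((k : ℝ) + 1) := by
                refine max_eq_right ?_
                by_contra h6
                have : t k x = 1 / ((k : ℝ) + 1) := max_eq_left (not_le.1 h6).le
                linarith [hk1 k]
              have := min_le_left (r x) ((k : ℝ) + 1)
              linarith
            exact mul_nonneg_of_nonpos_of_nonpos (by linarith)
              (Real.log_nonpos (ht_pos k x).le h3)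
      nlinarith
    have hlim : ∀ x, Tendsto (fun k => r x * Real.log (t k x) - (t k x - 1)) atTop
        (𝓝 (InformationTheory.klFun (r x))) := fun x => by
      have ht : Tendsto (fun k => t k x) atTop (𝓝 (r x)) := by
        have h1 : Tendsto (fun k : ℕ => 1 / ((k : ℝ) + 1)) atTop (𝓝 0) :=
          tendsto_one_div_add_atTop_nhds_zero_nat
        have h2 : Tendsto (fun k : ℕ => min (r x) ((k : ℝ) + 1)) atTop (𝓝 (r x)) := by
          refine tendsto_const_nhds.congr' ?_
          filter_upwards [eventually_ge_atTop ⌈r x⌉₊] with k hk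
          rw [min_eq_left]
          have := (Nat.le_ceil (r x)).trans (Nat.cast_le.2 hk)
          linarith
        have := h1.max h2
        rwa [max_eq_right (hr0 x)] at this
      have he : InformationTheory.klFun (r x) = r x * Real.log (r x) - (r x - 1) := by
        rw [InformationTheory.klFun_apply]; ring
      rw [he]
      refine Tendsto.sub ?_ (ht.sub_const 1)
      rcases (hr0 x).eq_or_lt with h | h
      · simp [← h]
      · exact (ht.log h.ne').const_mul _
    have hfatou : ∫⁻ x, ENNReal.ofReal (InformationTheory.klFun (r x)) ∂Q ≤
        liminf (fun k => ∫⁻ x, ENNReal.ofReal (r x * Real.log (t k x) - (t k x - 1)) ∂Q) atTop := by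
      refine le_trans (le_of_eq (lintegral_congr fun x => ?_)) (lintegral_liminf_le fun k => ?_)
      · exact ((ENNReal.continuous_ofReal.tendsto _).comp (hlim x)).liminf_eq.symm
      · have := htm k
        fun_prop
    have hev := eventually_lt_of_lt_liminf (hc.trans_le hfatou)
    obtain ⟨k, hk⟩ := hev.exists
    refine ⟨fun x => Real.log (t k x), _, (htm k).log, hb k, ?_⟩
    obtain ⟨hi, he⟩ := variational_eq P Q hPQ (fun x => Real.log (t k x)) (htm k).log _ (hb k)
    have hexp : ∀ x, Real.exp (Real.log (t k x)) = t k x := fun x => Real.exp_log (ht_pos k x)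
    rw [he]
    simp only [hexp] at hi ⊢
    rwa [ofReal_integral_eq_lintegral_ofReal hi (ae_of_all _ (hF0 k))]
  · have hcT : c ≠ ⊤ := (hc.trans_le le_top).ne
    have : ∃ s, MeasurableSet s ∧ Q s = 0 ∧ P s ≠ 0 := by
      by_contra h
      push Not at h
      exact hPQ (Measure.AbsolutelyContinuous.mk fun s hs hQ => h s hs hQ)
    obtain ⟨s, hs, hQ, hP⟩ := this
    have hp : 0 < P.real s := ENNReal.toReal_pos hP (measure_ne_top _ _)
    let M : ℝ := (c.toReal + 1) / P.real s
    have hM : 0 ≤ M := by positivity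
    refine ⟨s.indicator fun _ => M, M, measurable_const.indicator hs, fun x => ?_, ?_⟩
    · by_cases hx : x ∈ s <;> simp [hx, abs_of_nonneg hM, hM]
    · have h1 : ∫ x, s.indicator (fun _ => M) x ∂P = c.toReal + 1 := by
        rw [integral_indicator_const _ hs]
        simp only [smul_eq_mul, M]
        field_simp
      have h2 : ∫ x, (Real.exp (s.indicator (fun _ => M) x) - 1) ∂Q = 0 := by
        refine integral_eq_zero_of_ae ?_
        have : ∀ᵐ x ∂Q, x ∉ s := measure_eq_zero_iff_ae_notMem.1 hQ
        filter_upwards [this] with x hx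
        simp [hx]
      rw [h1, h2, sub_zero, ENNReal.lt_ofReal_iff_toReal_lt hcT]
      linarith

lemma exists_continuous (P Q : Measure ℝ)
    [IsProbabilityMeasure P] [IsProbabilityMeasure Q] (c : ℝ≥0∞) (hc : c < klDiv P Q) :
    ∃ (g : ℝ → ℝ) (K : ℝ), Continuous g ∧ (∀ x, |g x| ≤ K) ∧
      c < ENNReal.ofReal (∫ x, g x ∂P - ∫ x, (Real.exp (g x) - 1) ∂Q) := by
  obtain ⟨g, K, hg, hK, hcg⟩ := exists_measurable P Q c hc
  have hK0 : 0 ≤ K := (abs_nonneg _).trans (hK 0)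
  have hcT : c ≠ ⊤ := (hcg.trans_le le_top).ne
  rw [ENNReal.lt_ofReal_iff_toReal_lt hcT] at hcg
  set J := ∫ x, g x ∂P - ∫ x, (Real.exp (g x) - 1) ∂Q with hJ
  have heK : 0 < Real.exp K := Real.exp_pos K
  let ε : ℝ := (J - c.toReal) / 2 / Real.exp K
  have hε : 0 < ε := div_pos (by linarith) heK
  obtain ⟨f0, hf0, -⟩ :=
    (bdd_integrable (P + Q) g hg K hK).exists_boundedContinuous_integral_sub_le hε
  let f : ℝ → ℝ := fun x => max (-K) (min K (f0 x))
  have hfc : Continuous f := by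
    have := f0.continuous
    fun_prop
  have hfK : ∀ x, |f x| ≤ K := fun x =>
    abs_le.2 ⟨le_max_left _ _, max_le (by linarith) (min_le_left _ _)⟩
  have hfg : ∀ x, |g x - f x| ≤ |g x - f0 x| := fun x => by
    have h1 : g x = max (-K) (min K (g x)) := by
      rw [min_eq_right ((abs_le.1 (hK x)).2), max_eq_right ((abs_le.1 (hK x)).1)]
    calc |g x - f x| = |max (-K) (min K (g x)) - max (-K) (min K (f0 x))| := by rw [← h1]
      _ ≤ |min K (g x) - min K (f0 x)| := by
        simpa using abs_max_sub_max_le_max (-K) (min K (g x)) (-K) (min K (f0 x))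
      _ ≤ _ := by
        simpa using abs_min_sub_min_le_max K (g x) K (f0 x)
  have hdm : Measurable fun x => |g x - f x| := by
    have := hfc.measurable
    fun_prop
  have hd2 : ∀ x, |(|g x - f x|)| ≤ K + K := fun x => by
    rw [abs_abs]
    exact (abs_sub _ _).trans (add_le_add (hK x) (hfK x))
  have hdi : ∀ (R : Measure ℝ) [IsFiniteMeasure R], Integrable (fun x => |g x - f x|) R :=
    fun R _ => bdd_integrable R _ hdm _ hd2
  have hsum : ∫ x, |g x - f x| ∂P + ∫ x, |g x - f x| ∂Q ≤ ε := by
    rw [← integral_add_measure (hdi P) (hdi Q)]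
    refine le_trans (integral_mono (hdi _) ?_ hfg) hf0
    refine ((bdd_integrable (P + Q) g hg K hK).sub ?_).abs
    exact f0.integrable _
  have hP : ∫ x, g x ∂P - ∫ x, f x ∂P ≤ ∫ x, |g x - f x| ∂P := by
    rw [← integral_sub (bdd_integrable P g hg K hK) (bdd_integrable P f hfc.measurable K hfK)]
    exact integral_mono ((bdd_integrable P g hg K hK).sub
      (bdd_integrable P f hfc.measurable K hfK)) (hdi P) fun x => le_abs_self _
  have hQ : ∫ x, (Real.exp (f x) - 1) ∂Q - ∫ x, (Real.exp (g x) - 1) ∂Q ≤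
      Real.exp K * ∫ x, |g x - f x| ∂Q := by
    have i1 := bdd_exp_integrable Q f hfc.measurable K hfK
    have i2 := bdd_exp_integrable Q g hg K hK
    rw [← integral_sub i1 i2, ← integral_const_mul]
    refine integral_mono (i1.sub i2) ((hdi Q).const_mul _) fun x => ?_
    have h1 := Real.add_one_le_exp (g x - f x)
    rw [Real.exp_sub, le_div_iff₀ (Real.exp_pos _)] at h1
    have h2 : Real.exp (f x) ≤ Real.exp K := Real.exp_le_exp.2 ((le_abs_self _).trans (hfK x))
    have h3 : f x - g x ≤ |g x - f x| := by rw [abs_sub_comm]; exact le_abs_self _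
    have h4 : Real.exp (f x) * (f x - g x) ≤ Real.exp (f x) * |g x - f x| :=
      mul_le_mul_of_nonneg_left h3 (Real.exp_pos _).le
    have h5 : Real.exp (f x) * |g x - f x| ≤ Real.exp K * |g x - f x| :=
      mul_le_mul_of_nonneg_right h2 (abs_nonneg _)
    show (Real.exp (f x) - 1) - (Real.exp (g x) - 1) ≤ Real.exp K * |g x - f x|
    nlinarith
  refine ⟨f, K, hfc, hfK, ?_⟩
  rw [ENNReal.lt_ofReal_iff_toReal_lt hcT]
  have h1 : 1 ≤ Real.exp K := Real.one_le_exp hK0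
  have h2 : 0 ≤ ∫ x, |g x - f x| ∂P := integral_nonneg fun x => abs_nonneg _
  have h3 : Real.exp K * ε = (J - c.toReal) / 2 := by
    simp only [ε]; field_simp
  have h4 : Real.exp K * (∫ x, |g x - f x| ∂P + ∫ x, |g x - f x| ∂Q) ≤ Real.exp K * ε :=
    mul_le_mul_of_nonneg_left hsum heK.le
  nlinarith

lemma chOut_upper {Ω : Type*} [MeasurableSpace Ω] (μ : Measure Ω) [IsProbabilityMeasure μ]
    (X X' N : Ω → ℝ) (hX : Measurable X) (hX' : Measurable X') (hN : Measurable N)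
    (hXN : IndepFun X N μ) (hX'N : IndepFun X' N μ) (snr : ℝ) :
    klDiv (μ.map (chOut X N snr)) (μ.map (chOut X' N snr)) ≤ klDiv (μ.map X) (μ.map X') := by
  have hm : Measurable fun p : ℝ × ℝ => Real.sqrt snr * p.1 + p.2 := by fun_prop
  have key : ∀ Z : Ω → ℝ, Measurable Z → IndepFun Z N μ →
      μ.map (chOut Z N snr) =
        ((μ.map Z) ⊗ₘ (Kernel.const ℝ (μ.map N))).map
          (fun p : ℝ × ℝ => Real.sqrt snr * p.1 + p.2) := fun Z hZ h => by
    haveI := Measure.isProbabilityMeasure_map (μ := μ) hZ.aemeasurable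
    haveI := Measure.isProbabilityMeasure_map (μ := μ) hN.aemeasurable
    rw [Measure.compProd_const,
      ← (indepFun_iff_map_prod_eq_prod_map_map hZ.aemeasurable hN.aemeasurable).1 h,
      Measure.map_map hm (hZ.prodMk hN)]
    rfl
  have hc : ∀ Z : Ω → ℝ, Measurable Z → Measurable (chOut Z N snr) := fun Z hZ =>
    (hZ.const_mul _).add hN
  haveI := Measure.isProbabilityMeasure_map (μ := μ) hX.aemeasurable
  haveI := Measure.isProbabilityMeasure_map (μ := μ) hX'.aemeasurable
  haveI := Measure.isProbabilityMeasure_map (μ := μ) hN.aemeasurable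
  haveI := Measure.isProbabilityMeasure_map (μ := μ) (hc X hX).aemeasurable
  haveI := Measure.isProbabilityMeasure_map (μ := μ) (hc X' hX').aemeasurable
  rw [klDiv_eq_mathlib, klDiv_eq_mathlib, key X hX hXN, key X' hX' hX'N]
  refine (InformationTheory.klDiv_map_le _ _ hm).trans ?_
  rw [InformationTheory.klDiv_compProd_left]

lemma chOut_weak {Ω : Type*} [MeasurableSpace Ω] (μ : Measure Ω) [IsProbabilityMeasure μ]
    (X N : Ω → ℝ) (hX : Measurable X) (hN : Measurable N) (f : ℝ → ℝ) (hf : Continuous f)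
    (K : ℝ) (hK : ∀ x, |f x| ≤ K) :
    Tendsto (fun snr : ℝ => ∫ y, f (y / Real.sqrt snr) ∂(μ.map (chOut X N snr))) atTop
      (𝓝 (∫ x, f x ∂(μ.map X))) := by
  have hc : ∀ snr, Measurable (chOut X N snr) := fun snr => (hX.const_mul _).add hN
  rw [integral_map hX.aemeasurable hf.aestronglyMeasurable]
  have : ∀ snr, ∫ y, f (y / Real.sqrt snr) ∂(μ.map (chOut X N snr)) =
      ∫ ω, f (chOut X N snr ω / Real.sqrt snr) ∂μ := fun snr =>
    integral_map (hc snr).aemeasurable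
      (hf.comp (continuous_id.div_const _)).aestronglyMeasurable
  simp only [this]
  refine tendsto_integral_filter_of_dominated_convergence (fun _ => K) ?_ ?_
    (integrable_const _) ?_
  · exact Eventually.of_forall fun snr =>
      (hf.measurable.comp ((hc snr).div_const _)).aestronglyMeasurable
  · exact Eventually.of_forall fun snr => ae_of_all _ fun ω => hK _
  · refine ae_of_all _ fun ω => (hf.tendsto _).comp ?_
    have h1 : Tendsto (fun snr : ℝ => X ω + N ω / Real.sqrt snr) atTop (𝓝 (X ω + 0)) :=
      tendsto_const_nhds.add (tendsto_const_nhds.div_atTop Real.tendsto_sqrt_atTop)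
    rw [add_zero] at h1
    refine h1.congr' ?_
    filter_upwards [eventually_gt_atTop 0] with snr hs
    have : Real.sqrt snr ≠ 0 := (Real.sqrt_pos.2 hs).ne'
    simp only [chOut]
    field_simp

/-- **Non-Gaussianness as high-SNR limit of output divergences** (Lemma 7): if `X'` is Gaussian
with the same mean and variance as `X`, and `Y = √snr·X + N`, `Y' = √snr·X' + N`, then
`D(P_X ‖ P_{X'}) = lim_{snr→∞} D(P_Y ‖ P_{Y'})`, where both sides may equal `+∞`. -/
theorem tendsto_klDiv_outputs_atTop
    {Ω : Type*} [MeasurableSpace Ω] (μ : Measure Ω) [IsProbabilityMeasure μ]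
    (X X' N : Ω → ℝ) (hX : Measurable X) (hX' : Measurable X') (hN : Measurable N)
    (hXN : IndepFun X N μ) (hX'N : IndepFun X' N μ)
    (hN_law : μ.map N = gaussianReal 0 1)
    (hX2 : Integrable (fun ω => X ω ^ 2) μ)
    (hvar : 0 < variance X μ)
    (hX'_law : μ.map X' = gaussianReal (∫ ω, X ω ∂μ) (variance X μ).toNNReal) :
    Tendsto (fun snr : ℝ => klDiv (μ.map (chOut X N snr)) (μ.map (chOut X' N snr)))
      atTop (𝓝 (klDiv (μ.map X) (μ.map X'))) := by
  haveI := Measure.isProbabilityMeasure_map (μ := μ) hX.aemeasurable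
  haveI := Measure.isProbabilityMeasure_map (μ := μ) hX'.aemeasurable
  refine tendsto_order.2 ⟨fun c hc => ?_, fun c hc => Eventually.of_forall fun snr =>
    (chOut_upper μ X X' N hX hX' hN hXN hX'N snr).trans_lt hc⟩
  obtain ⟨g, K, hg, hK, hcg⟩ := exists_continuous (μ.map X) (μ.map X') c hc
  have h1 := chOut_weak μ X N hX hN g hg K hK
  have h2 := chOut_weak μ X' N hX' hN (fun x => Real.exp (g x) - 1)
    (hg.rexp.sub continuous_const) (Real.exp K + 1) fun x => by
      refine (abs_sub _ _).trans ?_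
      rw [abs_of_pos (Real.exp_pos _), abs_one]
      have := Real.exp_le_exp.2 ((le_abs_self _).trans (hK x))
      linarith
  have h3 := (ENNReal.continuous_ofReal.tendsto _).comp (h1.sub h2)
  filter_upwards [(tendsto_order.1 h3).1 c hcg] with snr hs
  have hc : ∀ Z : Ω → ℝ, Measurable Z → Measurable (chOut Z N snr) := fun Z hZ =>
    (hZ.const_mul _).add hN
  haveI := Measure.isProbabilityMeasure_map (μ := μ) (hc X hX).aemeasurable
  haveI := Measure.isProbabilityMeasure_map (μ := μ) (hc X' hX').aemeasurable
  refine hs.trans_le ?_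
  exact variational_le _ _ (fun y => g (y / Real.sqrt snr))
    (hg.measurable.comp (measurable_id.div_const _)) K fun x => hK _
end
end
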